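/- (Low-distortion scaling.) Fix κ ∈ (0,1/2), diversity J, and SNR > 0, and let ρ(α) denote the infimum over total sampling rates ρ such that distortion α is achievable by the optimal (unrestricted) estimator in the joint sparsity model. Then there exist constants 0 < C⁻ ≤ C⁺ < ∞ (depending on κ, J, SNR) such that for all sufficiently small α > 0, C⁻·(1/α)^{2/J}·log(1/α) ≤ ρ(α) ≤ C⁺·(1/α)^{2/J}·log(1/α). -/

import Mathlib

open MeasureTheory ProbabilityTheory Real Filter Finset Topology
open scoped ENNReal NNReal

noncomputable section

namespace Sparsity

/-- Binary entropy function (natural logarithms). -/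
def Hb (p : ℝ) : ℝ := -(p * Real.log p) - (1 - p) * Real.log (1 - p)

/-- The metric entropy rate `R(κ, α)`. -/
def Rrate (κ α : ℝ) : ℝ :=
  if α < 1 - κ then Hb κ - κ * Hb α - (1 - κ) * Hb (κ * α / (1 - κ)) else 0

/-- The standard gaussian measure on `ℝ`. -/
def stdGaussian : Measure ℝ := gaussianReal 0 1

instance : IsProbabilityMeasure stdGaussian := by unfold stdGaussian; infer_instance

/-- i.i.d. standard gaussian measure on `ι → ℝ`. -/
def gaussianPi (ι : Type*) [Fintype ι] : Measure (ι → ℝ) := Measure.pi fun _ => stdGaussian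

instance (ι : Type*) [Fintype ι] : IsProbabilityMeasure (gaussianPi ι) := by
  unfold gaussianPi; infer_instance

/-- CDF of a normalized chi-square with `J` degrees of freedom,
i.e. the law of `(1/J) ∑_{j<J} U_j^2` with `U_j` i.i.d. standard gaussian. -/
def chiCDF (J : ℕ) (t : ℝ) : ℝ :=
  ((gaussianPi (Fin J)) {u | ∑ j, (u j) ^ 2 ≤ J * t}).toReal

/-- Quantile function `ξ_J` of the normalized chi-square with `J` degrees of freedom. -/
def xi (J : ℕ) (p : ℝ) : ℝ := sInf {t : ℝ | 0 ≤ t ∧ p ≤ chiCDF J t}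

/-- The diversity power `P_J(β) = ∫_0^β ξ_J(p) dp`. -/
def Ppow (J : ℕ) (β : ℝ) : ℝ := ∫ p in (0:ℝ)..β, xi J p

/-- All sparsity patterns: size-`k` subsets of `{1,…,n}`. -/
def patterns (n k : ℕ) : Finset (Finset (Fin n)) := Finset.powersetCard k Finset.univ

/-- The underlying randomness for the joint sparsity model: nonzero values `ω.1`,
measurement matrices `ω.2.1`, and additive noise `ω.2.2`. -/
abbrev Omega (n m J : ℕ) : Type :=
  (Fin J → Fin n → ℝ) × (Fin J → Fin m → Fin n → ℝ) × (Fin J → Fin m → ℝ)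

/-- The law of the randomness: everything i.i.d. standard gaussian. -/
def omegaLaw (n m J : ℕ) : Measure (Omega n m J) :=
  (Measure.pi fun _ : Fin J => gaussianPi (Fin n)).prod
    ((Measure.pi fun _ : Fin J => Measure.pi fun _ : Fin m => gaussianPi (Fin n)).prod
      (Measure.pi fun _ : Fin J => gaussianPi (Fin m)))

/-- The sparse signal with pattern `S` and nonzero values `x`. -/
def signal (n : ℕ) (S : Finset (Fin n)) (x : Fin n → ℝ) : Fin n → ℝ :=
  fun i => if i ∈ S then x i else 0

/-- The noisy observations `Y_j = √(SNR/k)·A_j X_j + W_j`. -/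
def Yobs (n m J : ℕ) (SNR : ℝ) (k : ℕ) (S : Finset (Fin n)) (ω : Omega n m J) :
    Fin J → Fin m → ℝ :=
  fun j r =>
    Real.sqrt (SNR / k) * (∑ i, ω.2.1 j r i * signal n S (ω.1 j) i) + ω.2.2 j r

/-- Normalized distortion `d(S,T) = max(|S∖T|, |T∖S|)/k`. -/
def distor (k : ℕ) {n : ℕ} (S T : Finset (Fin n)) : ℝ :=
  (max (S \ T).card (T \ S).card : ℝ) / k

/-- A sparsity pattern estimator: a function of the observations `(Y_j)_j`
and of the measurement matrices `(A_j)_j`. -/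
abbrev Estimator (n m J : ℕ) : Type :=
  (Fin J → Fin m → ℝ) → (Fin J → Fin m → Fin n → ℝ) → Finset (Fin n)

/-- The probability that the estimator `est` makes distortion larger than `α`,
averaged over the uniformly distributed sparsity pattern. -/
def errProb (n m J k : ℕ) (SNR α : ℝ) (est : Estimator n m J) : ℝ :=
  (n.choose k : ℝ)⁻¹ * ∑ S ∈ patterns n k,
    (omegaLaw n m J
      {ω | α < distor k S (est (Yobs n m J SNR k S ω) ω.2.1)}).toReal

/-- Distortion `α` is achievable (by some estimator sequence) at sparsity rate `κ`,
signal-to-noise ratio `SNR`, total sampling rate `ρ` and diversity `J`. -/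
def achievable (κ SNR ρ : ℝ) (J : ℕ) (α : ℝ) : Prop :=
  ∃ (k m : ℕ → ℕ) (est : ∀ n, Estimator n (m n) J),
    Tendsto (fun n => (k n : ℝ) / n) atTop (𝓝 κ) ∧
    Tendsto (fun n => (J : ℝ) * (m n) / n) atTop (𝓝 ρ) ∧
    Tendsto (fun n => errProb n (m n) J (k n) SNR α (est n)) atTop (𝓝 0)

/-- The infimum total sampling rate at which distortion `α` is achievable. -/
def rhoStar (κ SNR : ℝ) (J : ℕ) (α : ℝ) : ℝ := sInf {ρ | achievable κ SNR ρ J α}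

end Sparsity

namespace Sparsity

lemma lintegral_pi_prod {ι : Type*} [Fintype ι] {E : ι → Type*} [∀ i, MeasurableSpace (E i)]
    (μ : ∀ i, Measure (E i)) [∀ i, IsProbabilityMeasure (μ i)] (f : ∀ i, E i → ℝ≥0∞)
    (hf : ∀ i, Measurable (f i)) :
    ∫⁻ x, ∏ i, f i (x i) ∂Measure.pi μ = ∏ i, ∫⁻ y, f i y ∂μ i := by
  have h := lintegral_prod_eq_prod_lintegral_of_indepFun (μ := Measure.pi μ) Finset.univ
    (fun i x => f i (x i)) (iIndepFun_pi (fun i => (hf i).aemeasurable))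
    (fun i => (hf i).comp (measurable_pi_apply i))
  rw [h]
  refine Finset.prod_congr rfl fun i _ => ?_
  exact (measurePreserving_eval μ i).lintegral_comp (hf i)

lemma pi_withDensity {ι : Type*} [Fintype ι] {E : ι → Type*} [∀ i, MeasurableSpace (E i)]
    (μ ν : ∀ i, Measure (E i)) [∀ i, IsProbabilityMeasure (μ i)] [∀ i, IsProbabilityMeasure (ν i)]
    (g : ∀ i, E i → ℝ≥0∞) (hg : ∀ i, Measurable (g i)) (h : ∀ i, ν i = (μ i).withDensity (g i)) :
    Measure.pi ν = (Measure.pi μ).withDensity (fun x => ∏ i, g i (x i)) := by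
  refine Measure.pi_eq fun s hs => ?_
  rw [withDensity_apply _ (MeasurableSet.univ_pi hs), ← lintegral_indicator (MeasurableSet.univ_pi hs)]
  have : ∀ x : (∀ i, E i), (Set.univ.pi s).indicator (fun x => ∏ i, g i (x i)) x
      = ∏ i, (s i).indicator (g i) (x i) := by
    intro x
    by_cases hx : x ∈ Set.univ.pi s
    · rw [Set.indicator_of_mem hx]
      exact Finset.prod_congr rfl fun i _ => by rw [Set.indicator_of_mem (hx i trivial)]
    · rw [Set.indicator_of_notMem hx]
      simp only [Set.mem_pi, Set.mem_univ, true_imp_iff, not_forall] at hx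
      obtain ⟨i, hi⟩ := hx
      exact (Finset.prod_eq_zero (Finset.mem_univ i) (Set.indicator_of_notMem hi _)).symm
  simp_rw [this]
  rw [lintegral_pi_prod _ _ fun i => (hg i).indicator (hs i)]
  refine Finset.prod_congr rfl fun i _ => ?_
  rw [lintegral_indicator (hs i), h i, withDensity_apply _ (hs i)]

lemma lintegral_exp_mul_stdGaussian (t : ℝ) :
    ∫⁻ x, ENNReal.ofReal (exp (t * x)) ∂stdGaussian = ENNReal.ofReal (exp (t ^ 2 / 2)) := by
  unfold stdGaussian
  rw [← ofReal_integral_eq_lintegral_ofReal (integrable_exp_mul_gaussianReal t)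
    (ae_of_all _ fun x => (exp_pos _).le)]
  have := congrFun (mgf_id_gaussianReal (μ := 0) (v := 1)) t
  simp only [mgf, id] at this
  rw [this]; simp

/-- Density of the standard gaussian shifted by `θ`. -/
def shiftDensity (θ w : ℝ) : ℝ≥0∞ := ENNReal.ofReal (exp (θ * w - θ ^ 2 / 2))

lemma measurable_shiftDensity (θ : ℝ) : Measurable (shiftDensity θ) := by
  unfold shiftDensity; fun_prop

lemma map_add_stdGaussian (θ : ℝ) :
    stdGaussian.map (· + θ) = stdGaussian.withDensity (shiftDensity θ) := by
  unfold stdGaussian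
  rw [gaussianReal_map_add_const, gaussianReal_of_var_ne_zero _ one_ne_zero,
    gaussianReal_of_var_ne_zero _ one_ne_zero,
    ← withDensity_mul _ (measurable_gaussianPDF 0 1) (measurable_shiftDensity θ)]
  congr 1
  ext x
  simp only [gaussianPDF, gaussianPDFReal, shiftDensity, Pi.mul_apply]
  rw [← ENNReal.ofReal_mul (by positivity), mul_assoc (√(2 * π * ((1 : ℝ≥0) : ℝ)))⁻¹, ← Real.exp_add]
  congr 3
  simp; ring

lemma lintegral_shiftDensity_sq (θ : ℝ) :
    ∫⁻ w, shiftDensity θ w ^ 2 ∂stdGaussian = ENNReal.ofReal (exp (θ ^ 2)) := by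
  have : ∀ w, shiftDensity θ w ^ 2
      = ENNReal.ofReal (exp (-θ ^ 2)) * ENNReal.ofReal (exp (2 * θ * w)) := by
    intro w
    unfold shiftDensity
    rw [← ENNReal.ofReal_pow (exp_pos _).le, ← ENNReal.ofReal_mul (exp_pos _).le, ← Real.exp_add,
      ← Real.exp_nat_mul]
    congr 2; push_cast; ring
  simp_rw [this]
  rw [lintegral_const_mul _ (by fun_prop), lintegral_exp_mul_stdGaussian,
    ← ENNReal.ofReal_mul (exp_pos _).le, ← Real.exp_add]
  congr 2; ring

/-- Truncated change of measure for a deterministic shift of white gaussian noise. -/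
lemma lintegral_shift_le {J m : ℕ} (θ : Fin J → Fin m → ℝ) (L : ℝ≥0∞) (hL : L ≠ 0) (hL' : L ≠ ⊤)
    (f : (Fin J → Fin m → ℝ) → ℝ≥0∞) (hf : Measurable f) (hf1 : ∀ w, f w ≤ 1) :
    ∫⁻ w, f (w + θ) ∂(Measure.pi fun _ : Fin J => gaussianPi (Fin m)) ≤
      L * ∫⁻ w, f w ∂(Measure.pi fun _ : Fin J => gaussianPi (Fin m))
        + L⁻¹ * ENNReal.ofReal (exp (∑ j, ∑ r, θ j r ^ 2)) := by
  set μ := (Measure.pi fun _ : Fin J => gaussianPi (Fin m)) with hμ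
  have hrow : ∀ j, (gaussianPi (Fin m)).map (· + θ j)
      = (gaussianPi (Fin m)).withDensity (fun w => ∏ r, shiftDensity (θ j r) (w r)) := by
    intro j
    have hp : ∀ r, IsProbabilityMeasure (stdGaussian.map (· + θ j r)) := fun r =>
      Measure.isProbabilityMeasure_map (by fun_prop)
    unfold gaussianPi
    rw [← pi_withDensity (fun _ => stdGaussian) (fun r => stdGaussian.map (· + θ j r)) _
      (fun r => measurable_shiftDensity _) (fun r => map_add_stdGaussian _)]
    exact Measure.pi_map_pi (μ := fun _ : Fin m => stdGaussian) (f := fun r x => x + θ j r)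
      (fun r => by fun_prop)
  have hmr : ∀ j, Measurable (fun w : Fin m → ℝ => ∏ r, shiftDensity (θ j r) (w r)) := fun j =>
    Finset.measurable_prod _ fun r _ => (measurable_shiftDensity _).comp (measurable_pi_apply r)
  have hmap : μ.map (· + θ)
      = μ.withDensity (fun w => ∏ j, ∏ r, shiftDensity (θ j r) (w j r)) := by
    have hp : ∀ j, IsProbabilityMeasure ((gaussianPi (Fin m)).map (· + θ j)) := fun r =>
      Measure.isProbabilityMeasure_map (by fun_prop)
    rw [hμ, ← pi_withDensity (fun _ => gaussianPi (Fin m))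
      (fun j => (gaussianPi (Fin m)).map (· + θ j))
      (fun j w => ∏ r, shiftDensity (θ j r) (w r)) hmr hrow]
    exact Measure.pi_map_pi (μ := fun _ : Fin J => gaussianPi (Fin m)) (f := fun j x => x + θ j)
      (fun r => by fun_prop)
  set R : (Fin J → Fin m → ℝ) → ℝ≥0∞ := fun w => ∏ j, ∏ r, shiftDensity (θ j r) (w j r) with hR
  have hRm : Measurable R :=
    Finset.measurable_prod _ fun j _ => (hmr j).comp (measurable_pi_apply j)
  have hR2 : ∫⁻ w, R w ^ 2 ∂μ = ENNReal.ofReal (exp (∑ j, ∑ r, θ j r ^ 2)) := by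
    have : ∀ w, R w ^ 2 = ∏ j, ((∏ r, shiftDensity (θ j r) (w j r)) ^ 2) := fun w => by
      rw [hR, Finset.prod_pow]
    simp_rw [this]
    rw [hμ, lintegral_pi_prod (fun _ => gaussianPi (Fin m))
      (fun j w => (∏ r, shiftDensity (θ j r) (w r)) ^ 2) fun j => (hmr j).pow_const 2,
      Real.exp_sum, ENNReal.ofReal_prod_of_nonneg fun _ _ => (exp_pos _).le]
    refine Finset.prod_congr rfl fun j _ => ?_
    simp_rw [← Finset.prod_pow]
    unfold gaussianPi
    rw [lintegral_pi_prod (fun _ => stdGaussian)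
      (fun r w => (shiftDensity (θ j r) w) ^ 2) fun r => (measurable_shiftDensity _).pow_const 2,
      Real.exp_sum, ENNReal.ofReal_prod_of_nonneg fun _ _ => (exp_pos _).le]
    exact Finset.prod_congr rfl fun r _ => lintegral_shiftDensity_sq _
  have h1 : ∫⁻ w, f (w + θ) ∂μ = ∫⁻ w, R w * f w ∂μ := by
    rw [← lintegral_map (f := f) (g := (· + θ)) hf (by fun_prop), hmap,
      lintegral_withDensity_eq_lintegral_mul _ hRm hf]
    rfl
  rw [h1, ← hR2, ← lintegral_const_mul _ hf, ← lintegral_const_mul _ (hRm.pow_const 2),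
    ← lintegral_add_left (hf.const_mul _)]
  refine lintegral_mono fun w => ?_
  dsimp only
  rcases le_total (R w) L with h | h
  · exact (mul_le_mul_left h _).trans le_self_add
  · calc R w * f w ≤ R w * 1 := mul_le_mul_right (hf1 w) _
      _ = L⁻¹ * (L * R w) := by rw [← mul_assoc, ENNReal.inv_mul_cancel hL hL', mul_one, one_mul]
      _ ≤ L⁻¹ * (R w ^ 2) := by rw [sq]; gcongr
      _ ≤ _ := le_add_self

lemma map_sum_gaussianPi {ι : Type*} [Fintype ι] (v : ι → ℝ) :
    (gaussianPi ι).map (fun a => ∑ i, a i * v i) = gaussianReal 0 (∑ i, ‖v i‖₊ ^ 2) := by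
  classical
  have hind : iIndepFun (fun i (a : ι → ℝ) => a i * v i) (gaussianPi ι) :=
    iIndepFun_pi (μ := fun _ : ι => stdGaussian) (X := fun i x => x * v i)
      (fun i => by fun_prop)
  have hmeas : ∀ i, Measurable (fun (a : ι → ℝ) => a i * v i) := fun i => by fun_prop
  have hlaw : ∀ i, (gaussianPi ι).map (fun a => a i * v i) = gaussianReal 0 (‖v i‖₊ ^ 2) := by
    intro i
    have h1 : (fun a : ι → ℝ => a i * v i) = (fun x => x * v i) ∘ (fun a : ι → ℝ => a i) := rfl
    have h2 : (gaussianPi ι).map (fun a : ι → ℝ => a i) = gaussianReal 0 1 :=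
      (measurePreserving_eval (fun _ : ι => stdGaussian) i).map_eq
    rw [h1, ← Measure.map_map (g := fun x => x * v i) (f := fun a : ι → ℝ => a i) (by fun_prop)
      (by fun_prop), h2]
    rw [gaussianReal_map_mul_const]
    congr 1
    · simp
    · ext; simp
  have key : ∀ s : Finset ι, (gaussianPi ι).map (∑ i ∈ s, fun a : ι → ℝ => a i * v i)
      = gaussianReal 0 (∑ i ∈ s, ‖v i‖₊ ^ 2) := by
    intro s
    induction s using Finset.induction_on with
    | empty =>
      simp only [Finset.sum_empty, gaussianReal_zero_var]
      have : (0 : (ι → ℝ) → ℝ) = fun _ => 0 := rfl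
      rw [this, Measure.map_const]; simp
    | insert j s hj ih =>
      rw [Finset.sum_insert hj, Finset.sum_insert hj]
      have := gaussianReal_add_gaussianReal_of_indepFun
        (hind.indepFun_finsetSum_of_notMem hmeas hj).symm (hlaw j) ih
      simpa using this
  have := key Finset.univ
  convert this using 2
  ext a; simp

lemma map_row {ι : Type*} [Fintype ι] (v : ι → ℝ) :
    ((gaussianPi ι).prod stdGaussian).map (fun p => ∑ i, p.1 i * v i + p.2)
      = gaussianReal 0 (∑ i, ‖v i‖₊ ^ 2 + 1) := by
  have hind : IndepFun (fun p : (ι → ℝ) × ℝ => ∑ i, p.1 i * v i) (fun p => p.2)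
      ((gaussianPi ι).prod stdGaussian) :=
    indepFun_prod (X := fun a : ι → ℝ => ∑ i, a i * v i) (Y := fun x : ℝ => x)
      (by fun_prop) (by fun_prop)
  have h1 : ((gaussianPi ι).prod stdGaussian).map (fun p => ∑ i, p.1 i * v i)
      = gaussianReal 0 (∑ i, ‖v i‖₊ ^ 2) := by
    have : (fun p : (ι → ℝ) × ℝ => ∑ i, p.1 i * v i)
      = (fun a : ι → ℝ => ∑ i, a i * v i) ∘ Prod.fst := rfl
    rw [this, ← Measure.map_map (by fun_prop) measurable_fst, measurePreserving_fst.map_eq,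
      map_sum_gaussianPi]
  have h2 : ((gaussianPi ι).prod stdGaussian).map (fun p => p.2) = gaussianReal 0 1 :=
    measurePreserving_snd.map_eq
  have := gaussianReal_add_gaussianReal_of_indepFun hind h1 h2
  simp only [add_zero] at this
  exact this

lemma neg_sub_sq_le_log {y : ℝ} (hy : |y| ≤ 1 / 2) : -y - 2 * y ^ 2 ≤ log (1 - y) := by
  have h := abs_log_sub_add_sum_range_le (x := y) (by linarith) 1
  simp only [Finset.sum_range_one, zero_add, pow_one, Nat.cast_zero, div_one] at h
  have h2 : |y| ^ (1 + 1) / (1 - |y|) ≤ 2 * y ^ 2 := by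
    rw [div_le_iff₀ (by linarith)]
    have : |y| ^ (1 + 1) = y ^ 2 := by rw [one_add_one_eq_two, sq_abs]
    rw [this]
    nlinarith [sq_nonneg y]
  have := (abs_le.1 (h.trans h2)).1
  linarith

lemma lintegral_exp_sq_stdGaussian_le {s : ℝ} (hs : |s| ≤ 1 / 4) :
    ∫⁻ x, ENNReal.ofReal (exp (s * (x ^ 2 - 1))) ∂stdGaussian ≤ ENNReal.ofReal (exp (4 * s ^ 2)) := by
  have hs1 := (abs_le.1 hs).1
  have hs2 := (abs_le.1 hs).2
  have hb : 0 < 1 / 2 - s := by linarith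
  unfold stdGaussian
  rw [gaussianReal_of_var_ne_zero _ one_ne_zero,
    lintegral_withDensity_eq_lintegral_mul _ (measurable_gaussianPDF 0 1) (by fun_prop)]
  have : ∀ x : ℝ, (gaussianPDF 0 1 * fun x => ENNReal.ofReal (exp (s * (x ^ 2 - 1)))) x
      = ENNReal.ofReal ((√(2 * π))⁻¹ * exp (-s) * exp (-(1 / 2 - s) * x ^ 2)) := by
    intro x
    simp only [gaussianPDF, gaussianPDFReal, Pi.mul_apply]
    rw [← ENNReal.ofReal_mul (by positivity), mul_assoc, mul_assoc (√(2 * π))⁻¹, ← Real.exp_add]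
    simp only [NNReal.coe_one, mul_one]
    rw [← Real.exp_add]
    congr 3
    ring
  simp_rw [this]
  rw [← ofReal_integral_eq_lintegral_ofReal ((integrable_exp_neg_mul_sq hb).const_mul _)
    (ae_of_all _ fun x => by positivity), integral_const_mul, integral_gaussian]
  apply ENNReal.ofReal_le_ofReal
  have h1 : (√(2 * π))⁻¹ * exp (-s) * √(π / (1 / 2 - s)) = exp (-s) * (√(1 - 2 * s))⁻¹ := by
    have : π / (1 / 2 - s) = (2 * π) * (1 - 2 * s)⁻¹ := by
      have : (1 - 2 * s) ≠ 0 := by linarith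
      field_simp
    rw [this, Real.sqrt_mul (x := 2 * π) (by positivity), Real.sqrt_inv]
    have : √(2 * π) ≠ 0 := by positivity
    field_simp
  rw [h1]
  have hpos : 0 < 1 - 2 * s := by linarith
  have h2 : (√(1 - 2 * s))⁻¹ = exp (-(log (1 - 2 * s) / 2)) := by
    rw [Real.exp_neg, ← Real.log_sqrt hpos.le, Real.exp_log (Real.sqrt_pos.2 hpos)]
  rw [h2, ← Real.exp_add]
  apply Real.exp_le_exp.2
  have := neg_sub_sq_le_log (y := 2 * s) (by rw [abs_mul, abs_two]; linarith)
  nlinarith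

lemma lintegral_exp_sq_gaussian_le {v : ℝ≥0} {l : ℝ} (hs : |l| * v ≤ 1 / 4) :
    ∫⁻ x, ENNReal.ofReal (exp (l * (x ^ 2 - v))) ∂(gaussianReal 0 v)
      ≤ ENNReal.ofReal (exp (4 * (l * v) ^ 2)) := by
  have : gaussianReal 0 v = stdGaussian.map (fun x => √v * x) := by
    unfold stdGaussian
    rw [gaussianReal_map_const_mul]
    congr 1
    · simp
    · ext; simp
  rw [this, lintegral_map (by fun_prop) (by fun_prop)]
  refine le_trans (le_of_eq ?_) (lintegral_exp_sq_stdGaussian_le (s := l * v) ?_)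
  · refine lintegral_congr fun x => ?_
    rw [mul_pow, Real.sq_sqrt v.coe_nonneg]
    congr 2; ring
  · rw [abs_mul, NNReal.abs_eq]; exact hs

/-- A Chernoff bound for sums of squares of i.i.d. gaussian rows. -/
lemma chernoff_rows {m : ℕ} {E : Type*} [MeasurableSpace E] (μ : Measure E) [IsProbabilityMeasure μ]
    (g : E → ℝ) (hg : Measurable g) (v : ℝ≥0) (hv : μ.map g = gaussianReal 0 v) {l η : ℝ}
    (hl : |l| * v ≤ 1 / 4) :
    (Measure.pi fun _ : Fin m => μ) {x | m * η ≤ l * (∑ r, g (x r) ^ 2 - m * v)}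
      ≤ ENNReal.ofReal (exp (m * (4 * (l * v) ^ 2 - η))) := by
  have hm : ∀ x : Fin m → E, ENNReal.ofReal (exp (l * (∑ r, g (x r) ^ 2 - m * v)))
      = ∏ r, ENNReal.ofReal (exp (l * (g (x r) ^ 2 - v))) := by
    intro x
    rw [← ENNReal.ofReal_prod_of_nonneg fun _ _ => (exp_pos _).le, ← Real.exp_sum,
      ← Finset.mul_sum, Finset.sum_sub_distrib]
    simp
  have hmeas : ∀ r : Fin m, Measurable fun y : E => ENNReal.ofReal (exp (l * (g y ^ 2 - v))) :=
    fun r => by fun_prop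
  have h_integral : ∫⁻ x, ENNReal.ofReal (exp (l * (∑ r, g (x r) ^ 2 - m * v)))
      ∂(Measure.pi fun _ : Fin m => μ) ≤ ENNReal.ofReal (exp (m * (4 * (l * v) ^ 2))) := by
    simp_rw [hm]
    rw [lintegral_pi_prod (fun _ : Fin m => μ)
      (fun _ y => ENNReal.ofReal (exp (l * (g y ^ 2 - v)))) hmeas]
    simp only [Finset.prod_const, Finset.card_univ, Fintype.card_fin]
    rw [Real.exp_nat_mul, ENNReal.ofReal_pow (exp_pos _).le]
    refine pow_le_pow_left' ?_ m
    rw [← lintegral_map (f := fun x => ENNReal.ofReal (exp (l * (x ^ 2 - v)))) (by fun_prop) hg, hv]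
    exact lintegral_exp_sq_gaussian_le hl
  have hmk := mul_meas_ge_le_lintegral₀ (μ := Measure.pi fun _ : Fin m => μ)
    (f := fun x => ENNReal.ofReal (exp (l * (∑ r, g (x r) ^ 2 - m * v))))
    (Measurable.aemeasurable (by fun_prop)) (ENNReal.ofReal (exp (m * η)))
  have hset : {x : Fin m → E | m * η ≤ l * (∑ r, g (x r) ^ 2 - m * v)}
      = {x | ENNReal.ofReal (exp (m * η))
          ≤ ENNReal.ofReal (exp (l * (∑ r, g (x r) ^ 2 - m * v)))} := by
    ext x
    simp only [Set.mem_ofPred_eq]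
    rw [ENNReal.ofReal_le_ofReal_iff (exp_pos _).le, Real.exp_le_exp]
  rw [hset]
  have hpos : ENNReal.ofReal (exp (m * η)) ≠ 0 := by simp [exp_pos]
  calc _ ≤ (∫⁻ x, ENNReal.ofReal (exp (l * (∑ r, g (x r) ^ 2 - m * v)))
      ∂(Measure.pi fun _ : Fin m => μ)) / ENNReal.ofReal (exp (m * η)) := by
        rw [ENNReal.le_div_iff_mul_le (Or.inl hpos) (Or.inl ENNReal.ofReal_ne_top), mul_comm]
        exact hmk
    _ ≤ ENNReal.ofReal (exp (m * (4 * (l * v) ^ 2))) / ENNReal.ofReal (exp (m * η)) := by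
        gcongr
    _ = _ := by
        rw [← ENNReal.ofReal_div_of_pos (exp_pos _), ← Real.exp_sub]
        congr 2; ring

lemma gaussian_small_ball_le (τ : ℝ) :
    stdGaussian {x | |x| ≤ τ} ≤ ENNReal.ofReal τ := by
  have hset : {x : ℝ | |x| ≤ τ} = Set.Icc (-τ) τ := by ext x; simp [abs_le]
  rw [hset]
  unfold stdGaussian
  rw [gaussianReal_apply _ one_ne_zero]
  calc ∫⁻ x in Set.Icc (-τ) τ, gaussianPDF 0 1 x
      ≤ ∫⁻ x in Set.Icc (-τ) τ, ENNReal.ofReal (1 / 2) := by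
        refine lintegral_mono fun x => ENNReal.ofReal_le_ofReal ?_
        unfold gaussianPDFReal
        have h1 : (√(2 * π * ((1 : ℝ≥0) : ℝ)))⁻¹ ≤ 1 / 2 := by
          rw [one_div]
          refine inv_anti₀ two_pos (Real.le_sqrt_of_sq_le ?_)
          have := Real.pi_gt_three
          push_cast; linarith
        have h2 : exp (-(x - 0) ^ 2 / (2 * ((1 : ℝ≥0) : ℝ))) ≤ 1 := by
          apply Real.exp_le_one_iff.2
          have := sq_nonneg (x - 0)
          push_cast; linarith
        calc _ ≤ (1 / 2 : ℝ) * 1 := mul_le_mul h1 h2 (exp_pos _).le (by norm_num)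
          _ = _ := by ring
    _ = ENNReal.ofReal τ := by
        rw [setLIntegral_const, Real.volume_Icc, ← ENNReal.ofReal_mul (by norm_num)]
        congr 1; ring

lemma le_gaussian_small_ball {τ : ℝ} (hτ1 : τ ≤ 1) :
    ENNReal.ofReal (τ / 4) ≤ stdGaussian {x | |x| ≤ τ} := by
  have hset : {x : ℝ | |x| ≤ τ} = Set.Icc (-τ) τ := by ext x; simp [abs_le]
  rw [hset]
  unfold stdGaussian
  rw [gaussianReal_apply _ one_ne_zero]
  calc ENNReal.ofReal (τ / 4) = ∫⁻ x in Set.Icc (-τ) τ, ENNReal.ofReal (1 / 8) := by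
        rw [setLIntegral_const, Real.volume_Icc, ← ENNReal.ofReal_mul (by norm_num)]
        congr 1; ring
    _ ≤ ∫⁻ x in Set.Icc (-τ) τ, gaussianPDF 0 1 x := by
        refine setLIntegral_mono (measurable_gaussianPDF 0 1) fun x hx =>
          ENNReal.ofReal_le_ofReal ?_
        unfold gaussianPDFReal
        have h1 : (1 / 3 : ℝ) ≤ (√(2 * π * ((1 : ℝ≥0) : ℝ)))⁻¹ := by
          rw [one_div]
          refine inv_anti₀ (by positivity) (Real.sqrt_le_iff.2 ⟨by norm_num, ?_⟩)
          have := Real.pi_le_four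
          push_cast; linarith
        have h2 : (1 / 2 : ℝ) ≤ exp (-(x - 0) ^ 2 / (2 * ((1 : ℝ≥0) : ℝ))) := by
          refine le_trans ?_ (Real.add_one_le_exp _)
          have : x ^ 2 ≤ 1 := by nlinarith [hx.1, hx.2]
          push_cast; simp only [sub_zero]; linarith
        calc (1 / 8 : ℝ) ≤ 1 / 3 * (1 / 2) := by norm_num
          _ ≤ _ := mul_le_mul h1 h2 (by norm_num) (by positivity)

/-- The observed data: measurements together with the sensing matrices. -/
abbrev Obs (n m J : ℕ) : Type := (Fin J → Fin m → ℝ) × (Fin J → Fin m → Fin n → ℝ)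

/-- The data observed when the sparsity pattern is `S`. -/
def obs (n m J : ℕ) (SNR : ℝ) (k : ℕ) (S : Finset (Fin n)) (ω : Omega n m J) : Obs n m J :=
  (Yobs n m J SNR k S ω, ω.2.1)

instance (n m J : ℕ) : IsProbabilityMeasure (omegaLaw n m J) := by
  unfold omegaLaw; infer_instance

lemma continuous_obs (n m J : ℕ) (SNR : ℝ) (k : ℕ) (S : Finset (Fin n)) :
    Continuous (obs n m J SNR k S) := by
  unfold obs Yobs signal
  refine Continuous.prodMk ?_ (by fun_prop)
  refine continuous_pi fun j => continuous_pi fun r => ?_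
  refine Continuous.add (Continuous.mul continuous_const (continuous_finsetSum _ fun i _ => ?_))
    (by fun_prop)
  by_cases hi : i ∈ S
  · simp only [hi, if_true]; fun_prop
  · simp only [hi, if_false]; fun_prop

lemma measurable_obs (n m J : ℕ) (SNR : ℝ) (k : ℕ) (S : Finset (Fin n)) :
    Measurable (obs n m J SNR k S) := (continuous_obs n m J SNR k S).measurable

/-- Any estimator can be replaced by a measurable one at an arbitrarily small cost. -/
lemma exists_measurable_estimator {n m J k : ℕ} (SNR α : ℝ) (est : Estimator n m J)
    {ε : ℝ≥0∞} (hε : ε ≠ 0) :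
    ∃ est' : Obs n m J → Finset (Fin n), (∀ T, MeasurableSet {p | est' p = T}) ∧
      ∀ S, omegaLaw n m J {ω | α < distor k S (est' (obs n m J SNR k S ω))} ≤
        omegaLaw n m J {ω | α < distor k S (est (Yobs n m J SNR k S ω) ω.2.1)} + ε := by
  classical
  set μ := omegaLaw n m J
  set E : Finset (Fin n) → Set (Omega n m J) :=
    fun S => {ω | α < distor k S (est (Yobs n m J SNR k S ω) ω.2.1)} with hE
  have hK : ∀ S, ∃ K ⊆ (toMeasurable μ (E S))ᶜ, IsCompact K ∧
      μ (toMeasurable μ (E S))ᶜ < μ K + ε := fun S => by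
    obtain ⟨K, hK, hKc, hlt⟩ :=
      (innerRegular_isCompact_isClosed_measurableSet_of_finite μ).exists_subset_lt_add
        ⟨isCompact_empty, isClosed_empty⟩ (measurableSet_toMeasurable μ (E S)).compl
        (measure_ne_top _ _) hε
    exact ⟨K, hK, hKc.1, hlt⟩
  choose K hKE hKc hKμ using hK
  set D : Finset (Fin n) → Set (Obs n m J) := fun S => obs n m J SNR k S '' K S with hD
  have hDm : ∀ S, MeasurableSet (D S) := fun S =>
    ((hKc S).image (continuous_obs n m J SNR k S)).measurableSet
  let C : Obs n m J → Finset (Finset (Fin n)) := fun p => Finset.univ.filter fun S => p ∈ D S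
  let F : Finset (Finset (Fin n)) → Finset (Fin n) := fun c =>
    if h : ∃ T, ∀ S ∈ c, distor k S T ≤ α then h.choose else ∅
  have hF : ∀ c T, (∀ S ∈ c, distor k S T ≤ α) → ∀ S ∈ c, distor k S (F c) ≤ α := by
    intro c T hT
    have h : ∃ T, ∀ S ∈ c, distor k S T ≤ α := ⟨T, hT⟩
    simp only [F, dif_pos h]
    exact h.choose_spec
  refine ⟨fun p => F (C p), fun T => ?_, fun S => ?_⟩
  · have hset : {p | F (C p) = T} = ⋃ c ∈ {c | F c = T}, ⋂ S, {p | p ∈ D S ↔ S ∈ c} := by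
      ext p
      simp only [Set.mem_ofPred_eq, Set.mem_iUnion, Set.mem_iInter, exists_prop]
      constructor
      · intro h
        exact ⟨C p, h, fun S => by simp [C]⟩
      · rintro ⟨c, hc, h⟩
        have : C p = c := by ext S; simp [C, h S]
        rw [this]; exact hc
    rw [hset]
    refine MeasurableSet.biUnion (Set.to_countable _) fun c _ => MeasurableSet.iInter fun S => ?_
    by_cases hS : S ∈ c
    · simpa [hS] using hDm S
    · simpa [hS, Set.compl_def] using (hDm S).compl
  · have hsub : {ω | α < distor k S (F (C (obs n m J SNR k S ω)))} ⊆ (K S)ᶜ := by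
      intro ω hω hωK
      refine not_le.2 hω (hF _ (est (obs n m J SNR k S ω).1 (obs n m J SNR k S ω).2) ?_ S ?_)
      · intro S' hS'
        obtain ⟨ω', hω', heq⟩ := (Finset.mem_filter.1 hS').2
        rw [← heq]
        by_contra hcon
        exact hKE S' hω' (subset_toMeasurable μ (E S') (not_le.1 hcon))
      · simp only [C, Finset.mem_filter, Finset.mem_univ, true_and]
        exact ⟨ω, hωK, rfl⟩
    refine (measure_mono hsub).trans ?_
    rw [prob_compl_eq_one_sub (hKc S).measurableSet, ← measure_toMeasurable (E S)]
    have h1 := prob_compl_eq_one_sub (μ := μ) (measurableSet_toMeasurable μ (E S)).compl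
    rw [compl_compl] at h1
    rw [h1, tsub_le_iff_right]
    calc (1 : ℝ≥0∞) ≤ 1 - μ (toMeasurable μ (E S))ᶜ + μ (toMeasurable μ (E S))ᶜ :=
          le_tsub_add
      _ ≤ 1 - μ (toMeasurable μ (E S))ᶜ + (μ (K S) + ε) := by gcongr; exact (hKμ S).le
      _ = _ := by ring

lemma measurePreserving_update {ι : Type*} [Fintype ι] [DecidableEq ι] (i : ι) :
    MeasurePreserving (fun p : (ι → ℝ) × ℝ => Function.update p.1 i p.2)
      ((gaussianPi ι).prod stdGaussian) (gaussianPi ι) := by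
  have hm : Measurable (fun p : (ι → ℝ) × ℝ => Function.update p.1 i p.2) := by
    refine measurable_pi_iff.2 fun l => ?_
    by_cases h : l = i
    · subst h; simpa using measurable_snd
    · simp only [Function.update_of_ne h]; fun_prop
  refine ⟨hm, ?_⟩
  unfold gaussianPi
  symm
  refine Measure.pi_eq fun s hs => ?_
  rw [Measure.map_apply hm (MeasurableSet.univ_pi hs)]
  have hset : (fun p : (ι → ℝ) × ℝ => Function.update p.1 i p.2) ⁻¹' Set.univ.pi s
      = (Set.univ.pi (Function.update s i Set.univ)) ×ˢ s i := by
    ext p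
    simp only [Set.mem_preimage, Set.mem_pi, Set.mem_univ, true_imp_iff, Set.mem_prod]
    constructor
    · intro h
      refine ⟨fun l => ?_, by simpa using h i⟩
      by_cases hl : l = i
      · subst hl; simp
      · simpa [Function.update_of_ne hl] using h l
    · rintro ⟨h1, h2⟩ l
      by_cases hl : l = i
      · subst hl; simpa using h2
      · simpa [Function.update_of_ne hl] using h1 l
  rw [hset, Measure.prod_prod, Measure.pi_pi, ← Finset.mul_prod_erase _ _ (Finset.mem_univ i),
    ← Finset.mul_prod_erase (a := i) _ (fun l => stdGaussian (s l)) (Finset.mem_univ i)]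
  simp only [Function.update_self, measure_univ, one_mul]
  rw [mul_comm]
  congr 1
  refine Finset.prod_congr rfl fun l hl => ?_
  rw [Function.update_of_ne (Finset.ne_of_mem_erase hl)]

/-- Resampling the `i`-th coordinate of all signals. -/
def resample {n J : ℕ} (i : Fin n) (p : (Fin J → Fin n → ℝ) × (Fin J → ℝ)) : Fin J → Fin n → ℝ :=
  fun j => Function.update (p.1 j) i (p.2 j)

lemma measurePreserving_resample {n J : ℕ} (i : Fin n) :
    MeasurePreserving (resample (J := J) i)
      ((Measure.pi fun _ : Fin J => gaussianPi (Fin n)).prod (gaussianPi (Fin J)))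
      (Measure.pi fun _ : Fin J => gaussianPi (Fin n)) :=
  (measurePreserving_pi _ _ fun _ : Fin J => measurePreserving_update i).comp
    (measurePreserving_arrowProdEquivProdArrow (Fin n → ℝ) ℝ (Fin J)
      (fun _ => gaussianPi (Fin n)) (fun _ => stdGaussian)).symm

lemma lintegral_exp_energy_le {n m J : ℕ} (i : Fin n) {s : ℝ} (hs : 0 ≤ s) (hs' : s ≤ 1 / 4) :
    ∫⁻ A, ENNReal.ofReal (exp (∑ j, ∑ r, s * A j r i ^ 2))
      ∂(Measure.pi fun _ : Fin J => Measure.pi fun _ : Fin m => gaussianPi (Fin n))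
      ≤ ENNReal.ofReal (exp (2 * s * (m * J))) := by
  have hcol : ∫⁻ a, ENNReal.ofReal (exp (s * a i ^ 2)) ∂(gaussianPi (Fin n))
      ≤ ENNReal.ofReal (exp (2 * s)) := by
    have h1 : ∫⁻ a, ENNReal.ofReal (exp (s * a i ^ 2)) ∂(gaussianPi (Fin n))
        = ∫⁻ x, ENNReal.ofReal (exp (s * x ^ 2)) ∂stdGaussian :=
      (measurePreserving_eval (fun _ : Fin n => stdGaussian) i).lintegral_comp
        (f := fun x => ENNReal.ofReal (exp (s * x ^ 2))) (by fun_prop)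
    rw [h1]
    have h2 : ∀ x : ℝ, ENNReal.ofReal (exp (s * x ^ 2))
        = ENNReal.ofReal (exp s) * ENNReal.ofReal (exp (s * (x ^ 2 - 1))) := fun x => by
      rw [← ENNReal.ofReal_mul (exp_pos _).le, ← Real.exp_add]
      congr 2; ring
    simp_rw [h2]
    rw [lintegral_const_mul _ (by fun_prop)]
    calc _ ≤ ENNReal.ofReal (exp s) * ENNReal.ofReal (exp (4 * s ^ 2)) := by
          gcongr
          exact lintegral_exp_sq_stdGaussian_le (by rw [abs_of_nonneg hs]; exact hs')
      _ ≤ _ := by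
          rw [← ENNReal.ofReal_mul (exp_pos _).le, ← Real.exp_add]
          apply ENNReal.ofReal_le_ofReal
          apply Real.exp_le_exp.2
          nlinarith
  have hprod : ∀ A : Fin J → Fin m → Fin n → ℝ,
      ENNReal.ofReal (exp (∑ j, ∑ r, s * A j r i ^ 2))
        = ∏ j, ∏ r, ENNReal.ofReal (exp (s * A j r i ^ 2)) := by
    intro A
    rw [Real.exp_sum, ENNReal.ofReal_prod_of_nonneg fun _ _ => (exp_pos _).le]
    refine Finset.prod_congr rfl fun j _ => ?_
    rw [Real.exp_sum, ENNReal.ofReal_prod_of_nonneg fun _ _ => (exp_pos _).le]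
  simp_rw [hprod]
  rw [lintegral_pi_prod (fun _ : Fin J => Measure.pi fun _ : Fin m => gaussianPi (Fin n))
    (fun _ (B : Fin m → Fin n → ℝ) => ∏ r, ENNReal.ofReal (exp (s * B r i ^ 2)))
    (fun _ => by fun_prop)]
  rw [lintegral_pi_prod (fun _ : Fin m => gaussianPi (Fin n))
    (fun _ (a : Fin n → ℝ) => ENNReal.ofReal (exp (s * a i ^ 2))) (fun _ => by fun_prop)]
  simp only [Finset.prod_const, Finset.card_univ, Fintype.card_fin]
  rw [← pow_mul]
  calc _ ≤ (ENNReal.ofReal (exp (2 * s))) ^ (m * J) := pow_le_pow_left' hcol _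
    _ = _ := by
      rw [← ENNReal.ofReal_pow (exp_pos _).le, ← Real.exp_nat_mul]
      congr 2; push_cast; ring

lemma Yobs_insert_resample {n m J k : ℕ} {SNR : ℝ} {S : Finset (Fin n)} {i : Fin n} (hi : i ∉ S)
    (X : Fin J → Fin n → ℝ) (z : Fin J → ℝ) (A : Fin J → Fin m → Fin n → ℝ)
    (W : Fin J → Fin m → ℝ) :
    Yobs n m J SNR k (insert i S) (resample i (X, z), A, W) =
      Yobs n m J SNR k S (X, A, W + fun j r => Real.sqrt (SNR / k) * z j * A j r i) := by
  funext j r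
  have hsig : ∀ l, A j r l * signal n (insert i S) (resample i (X, z) j) l =
      A j r l * signal n S (X j) l + if l = i then A j r i * z j else 0 := by
    intro l
    by_cases hl : l = i
    · subst hl; simp [signal, resample, hi]
    · simp [signal, resample, hl]
  simp only [Yobs, hsig, Finset.sum_add_distrib, Finset.sum_ite_eq', Finset.mem_univ, if_true,
    Pi.add_apply]
  ring

/-- Adding one index carrying small coefficients to the pattern changes probabilities of
observable events by a controlled amount. -/
lemma omegaLaw_insert_le {n m J k : ℕ} {SNR τ : ℝ} (hSNR : 0 ≤ SNR)
    (hs : SNR / k * τ ^ 2 ≤ 1 / 4) {S : Finset (Fin n)} {i : Fin n} (hi : i ∉ S)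
    {H : Set (Obs n m J)} (hH : MeasurableSet H) (L : ℝ≥0∞) (hL : L ≠ 0) (hL' : L ≠ ⊤) :
    omegaLaw n m J {ω | (∀ j, |ω.1 j i| ≤ τ) ∧ obs n m J SNR k (insert i S) ω ∈ H} ≤
      (stdGaussian {x | |x| ≤ τ}) ^ J *
        (L * omegaLaw n m J {ω | obs n m J SNR k S ω ∈ H} +
          L⁻¹ * ENNReal.ofReal (exp (2 * (SNR / k * τ ^ 2) * (m * J)))) := by
  have hsm : MeasurableSet {x : ℝ | |x| ≤ τ} := measurableSet_le (by fun_prop) (by fun_prop)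
  set νX := Measure.pi fun _ : Fin J => gaussianPi (Fin n)
  set νA := Measure.pi fun _ : Fin J => Measure.pi fun _ : Fin m => gaussianPi (Fin n) with hνA
  set νW := Measure.pi fun _ : Fin J => gaussianPi (Fin m) with hνW
  set E : Set (Omega n m J) :=
    {ω | (∀ j, |ω.1 j i| ≤ τ) ∧ obs n m J SNR k (insert i S) ω ∈ H} with hEdef
  set E0 : Set (Omega n m J) := {ω | obs n m J SNR k S ω ∈ H} with hE0def
  have hE0 : MeasurableSet E0 := measurable_obs n m J SNR k S hH
  have hE : MeasurableSet E := by
    have h1 : MeasurableSet {ω : Omega n m J | ∀ j, |ω.1 j i| ≤ τ} := by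
      rw [Set.ofPred_forall]
      exact MeasurableSet.iInter fun j => measurableSet_le (by fun_prop) (by fun_prop)
    exact h1.inter (measurable_obs n m J SNR k (insert i S) hH)
  have hsplit : ∀ B : Set (Omega n m J), MeasurableSet B →
      omegaLaw n m J B = ∫⁻ X, (νA.prod νW) (Prod.mk X ⁻¹' B) ∂νX := fun B hB => by
    unfold omegaLaw
    exact Measure.prod_apply hB
  set M := ENNReal.ofReal (exp (2 * (SNR / k * τ ^ 2) * (m * J)))
  set Z : Set (Fin J → ℝ) := Set.univ.pi fun _ => {x | |x| ≤ τ} with hZdef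
  have hZ : MeasurableSet Z := MeasurableSet.univ_pi fun _ => hsm
  have hbound : ∀ X z, (νA.prod νW) (Prod.mk (resample i (X, z)) ⁻¹' E) ≤
      Z.indicator 1 z * (L * (νA.prod νW) (Prod.mk X ⁻¹' E0) + L⁻¹ * M) := by
    intro X z
    by_cases hz : z ∈ Z
    · rw [Set.indicator_of_mem hz, Pi.one_apply, one_mul]
      rw [Measure.prod_apply (measurable_prodMk_left hE),
        Measure.prod_apply (measurable_prodMk_left hE0)]
      have hkey : ∀ A, νW (Prod.mk A ⁻¹' (Prod.mk (resample i (X, z)) ⁻¹' E)) ≤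
          L * νW (Prod.mk A ⁻¹' (Prod.mk X ⁻¹' E0)) + L⁻¹ * ENNReal.ofReal
            (exp (∑ j, ∑ r, SNR / k * τ ^ 2 * A j r i ^ 2)) := by
        intro A
        set G : Set (Fin J → Fin m → ℝ) := Prod.mk A ⁻¹' (Prod.mk X ⁻¹' E0)
        have hG : MeasurableSet G := measurable_prodMk_left (measurable_prodMk_left hE0)
        set θ : Fin J → Fin m → ℝ := fun j r => Real.sqrt (SNR / k) * z j * A j r i
        have h1 := lintegral_shift_le θ L hL hL' (G.indicator 1)
          (measurable_one.indicator hG) (fun w => Set.indicator_le_self' (by simp) w)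
        rw [lintegral_indicator_one hG] at h1
        have h2 : νW (Prod.mk A ⁻¹' (Prod.mk (resample i (X, z)) ⁻¹' E)) ≤
            ∫⁻ w, G.indicator 1 (w + θ) ∂νW := by
          have hGθ : MeasurableSet ((fun w => w + θ) ⁻¹' G) :=
            (measurable_id.add_const θ) hG
          have h3 : ∀ w, G.indicator (1 : (Fin J → Fin m → ℝ) → ℝ≥0∞) (w + θ) =
              ((fun w => w + θ) ⁻¹' G).indicator 1 w := fun w => rfl
          simp_rw [h3]
          rw [lintegral_indicator_one hGθ]
          refine measure_mono fun w hw => ?_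
          have hw2 := hw.2
          simp only [obs, Yobs_insert_resample hi] at hw2
          exact hw2
        refine h2.trans (h1.trans ?_)
        gcongr with j _ r _
        have hzj : z j ^ 2 ≤ τ ^ 2 := by
          have hzj' : |z j| ≤ τ := hz j (Set.mem_univ j)
          exact sq_le_sq.2 (hzj'.trans (le_abs_self τ))
        calc θ j r ^ 2 = SNR / k * z j ^ 2 * A j r i ^ 2 := by
              simp only [θ, mul_pow, Real.sq_sqrt (show 0 ≤ SNR / k by positivity)]
          _ ≤ _ := by gcongr
      refine (lintegral_mono hkey).trans ?_
      have hm0 : Measurable fun A => νW (Prod.mk A ⁻¹' (Prod.mk X ⁻¹' E0)) :=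
        measurable_measure_prodMk_left (measurable_prodMk_left hE0)
      rw [lintegral_add_left (hm0.const_mul _), lintegral_const_mul _ hm0,
        lintegral_const_mul _ (by fun_prop)]
      gcongr
      exact lintegral_exp_energy_le i (by positivity) hs
    · have : Prod.mk (resample i (X, z)) ⁻¹' E = (∅ : Set _) := by
        ext p
        simp only [Set.mem_preimage, Set.mem_empty_iff_false, iff_false, hEdef, Set.mem_ofPred_eq]
        rintro ⟨h, -⟩
        exact hz fun j _ => by simpa [resample] using h j
      rw [this]; simp
  have hmX : Measurable fun X => (νA.prod νW) (Prod.mk X ⁻¹' E) := measurable_measure_prodMk_left hE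
  have hmX0 : Measurable fun X => (νA.prod νW) (Prod.mk X ⁻¹' E0) :=
    measurable_measure_prodMk_left hE0
  rw [hsplit E hE, hsplit E0 hE0, ← (measurePreserving_resample i).lintegral_comp hmX]
  calc _ ≤ ∫⁻ p, (L * (νA.prod νW) (Prod.mk p.1 ⁻¹' E0) + L⁻¹ * M) * Z.indicator 1 p.2
        ∂(νX.prod (gaussianPi (Fin J))) :=
        lintegral_mono fun p => (hbound p.1 p.2).trans (by rw [mul_comm])
    _ = (∫⁻ X, (L * (νA.prod νW) (Prod.mk X ⁻¹' E0) + L⁻¹ * M) ∂νX) *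
        ∫⁻ z, Z.indicator 1 z ∂(gaussianPi (Fin J)) :=
        lintegral_prod_mul ((hmX0.const_mul L).add_const _).aemeasurable (measurable_one.indicator hZ).aemeasurable
    _ = _ := by
        rw [lintegral_indicator_one hZ, lintegral_add_left (hmX0.const_mul _),
          lintegral_const_mul _ hmX0, lintegral_const, measure_univ, mul_one, mul_comm]
        congr 1
        unfold gaussianPi
        rw [hZdef, Measure.pi_pi]
        simp

lemma sum_patterns_erase {n k : ℕ} (hk : 1 ≤ k) (Q : Finset (Fin n) → Fin n → ℝ≥0∞) :
    ∑ S ∈ patterns n k, ∑ i ∈ S, Q (S.erase i) i =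
      ∑ S ∈ patterns n (k - 1), ∑ i ∈ Sᶜ, Q S i := by
  rw [Finset.sum_sigma', Finset.sum_sigma']
  refine Finset.sum_bij' (fun x _ => ⟨x.1.erase x.2, x.2⟩) (fun x _ => ⟨insert x.2 x.1, x.2⟩)
    ?_ ?_ ?_ ?_ ?_
  · rintro ⟨S, i⟩ h
    simp only [Finset.mem_sigma, patterns, Finset.mem_powersetCard_univ] at h ⊢
    exact ⟨by rw [Finset.card_erase_of_mem h.2, h.1], by simp⟩
  · rintro ⟨S, i⟩ h
    simp only [Finset.mem_sigma, patterns, Finset.mem_powersetCard_univ, Finset.mem_compl] at h ⊢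
    refine ⟨by rw [Finset.card_insert_of_notMem h.2, h.1]; omega, by simp⟩
  · rintro ⟨S, i⟩ h
    simp only [Finset.mem_sigma] at h
    simp [Finset.insert_erase h.2]
  · rintro ⟨S, i⟩ h
    simp only [Finset.mem_sigma, Finset.mem_compl] at h
    simp [Finset.erase_insert h.2]
  · rintro ⟨S, i⟩ h
    rfl

lemma sum_measure_le_of_count {Ω ι : Type*} [MeasurableSpace Ω] (μ : Measure Ω)
    [IsProbabilityMeasure μ] (s : Finset ι) (B : ι → Set Ω) (hB : ∀ i, MeasurableSet (B i))
    [∀ ω, DecidablePred fun i => ω ∈ B i] (c : ℝ)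
    (h : ∀ ω, ((s.filter fun i => ω ∈ B i).card : ℝ) ≤ c) :
    ∑ i ∈ s, μ (B i) ≤ ENNReal.ofReal c := by
  calc ∑ i ∈ s, μ (B i) = ∑ i ∈ s, ∫⁻ ω, (B i).indicator 1 ω ∂μ := by
        refine Finset.sum_congr rfl fun i _ => (lintegral_indicator_one (hB i)).symm
    _ = ∫⁻ ω, ∑ i ∈ s, (B i).indicator 1 ω ∂μ :=
        (lintegral_finsetSum _ fun i _ => measurable_one.indicator (hB i)).symm
    _ ≤ ∫⁻ _, ENNReal.ofReal c ∂μ := by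
        refine lintegral_mono fun ω => ?_
        have : ∑ i ∈ s, (B i).indicator (1 : Ω → ℝ≥0∞) ω =
            ENNReal.ofReal ((s.filter fun i => ω ∈ B i).card : ℝ) := by
          rw [ENNReal.ofReal_natCast, Finset.card_filter, Nat.cast_sum]
          refine Finset.sum_congr rfl fun i _ => ?_
          by_cases hi : ω ∈ B i <;> simp [hi]
        rw [this]
        exact ENNReal.ofReal_le_ofReal (h ω)
    _ = _ := by simp

lemma distor_le_iff {n k : ℕ} (hk : 1 ≤ k) {α : ℝ} {S T : Finset (Fin n)} :
    distor k S T ≤ α ↔ ((S \ T).card : ℝ) ≤ α * k ∧ ((T \ S).card : ℝ) ≤ α * k := by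
  have hk' : (0 : ℝ) < k := by exact_mod_cast hk
  unfold distor
  rw [div_le_iff₀ hk']
  exact max_le_iff

lemma counting_le {n m J k : ℕ} (hk : 1 ≤ k) {SNR τ α : ℝ} (hSNR : 0 ≤ SNR)
    (hα : 0 ≤ α) (hs : SNR / k * τ ^ 2 ≤ 1 / 4) (est : Obs n m J → Finset (Fin n))
    (hest : ∀ T, MeasurableSet {p | est p = T}) (L : ℝ≥0∞) (hL : L ≠ 0) (hL' : L ≠ ⊤) :
    (n.choose k : ℝ≥0∞) * (k * (stdGaussian {x | |x| ≤ τ}) ^ J) ≤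
      (stdGaussian {x | |x| ≤ τ}) ^ J *
        (L * ((n.choose (k - 1) : ℝ≥0∞) * ENNReal.ofReal (α * k + 1)) +
          n.choose k * (k * (L⁻¹ * ENNReal.ofReal (exp (2 * (SNR / k * τ ^ 2) * (m * J)))))) +
      n.choose k * ENNReal.ofReal (α * k) +
      k * ∑ S ∈ patterns n k, omegaLaw n m J {ω | α < distor k S (est (obs n m J SNR k S ω))} := by
  classical
  have hP : ∀ P : Finset (Fin n) → Prop, MeasurableSet {p | P (est p)} := by
    intro P
    have : {p | P (est p)} = ⋃ T ∈ {T | P T}, {p | est p = T} := by ext; simp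
    rw [this]
    exact MeasurableSet.biUnion (Set.to_countable _) fun T _ => hest T
  set μ := omegaLaw n m J
  set p := (stdGaussian {x | |x| ≤ τ}) ^ J with hp
  set M := ENNReal.ofReal (exp (2 * (SNR / k * τ ^ 2) * (m * J)))
  set H : Finset (Fin n) → Fin n → Set (Obs n m J) :=
    fun S i => {q | i ∈ est q ∧ ((est q \ S).card : ℝ) ≤ α * k + 1} with hH
  have hHm : ∀ S i, MeasurableSet (H S i) := fun S i =>
    hP fun T => i ∈ T ∧ ((T \ S).card : ℝ) ≤ α * k + 1
  set Q : Finset (Fin n) → Fin n → ℝ≥0∞ := fun S i => μ {ω | obs n m J SNR k S ω ∈ H S i} with hQ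
  set Er : Finset (Fin n) → Set (Omega n m J) :=
    fun S => {ω | α < distor k S (est (obs n m J SNR k S ω))} with hEr
  set sm : Fin n → Set (Omega n m J) := fun i => {ω | ∀ j, |ω.1 j i| ≤ τ} with hsm
  have hsmm : ∀ i, MeasurableSet (sm i) := fun i => by
    simp only [hsm, Set.ofPred_forall]
    exact MeasurableSet.iInter fun j => measurableSet_le (by fun_prop) (by fun_prop)
  have hErm : ∀ S, MeasurableSet (Er S) := fun S =>
    measurable_obs n m J SNR k S (hP fun T => α < distor k S T)
  have hsmall : ∀ i, μ (sm i) = p := by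
    intro i
    have h1 : MeasurePreserving (fun ω : Omega n m J => ω.1) μ
        (Measure.pi fun _ : Fin J => gaussianPi (Fin n)) := measurePreserving_fst
    have h2 : MeasurePreserving (fun (X : Fin J → Fin n → ℝ) j => X j i)
        (Measure.pi fun _ : Fin J => gaussianPi (Fin n)) (gaussianPi (Fin J)) :=
      measurePreserving_pi _ _ fun _ => measurePreserving_eval (fun _ : Fin n => stdGaussian) i
    have h3 := (h2.comp h1).measure_preimage
      (s := Set.univ.pi fun _ : Fin J => {x : ℝ | |x| ≤ τ})
      (MeasurableSet.univ_pi fun _ => measurableSet_le (by fun_prop) (by fun_prop)).nullMeasurableSet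
    have h4 : (gaussianPi (Fin J)) (Set.univ.pi fun _ : Fin J => {x : ℝ | |x| ≤ τ}) = p := by
      unfold gaussianPi; rw [Measure.pi_pi]; simp [hp]
    rw [← h4, ← h3]
    congr 1
    ext ω; simp [hsm]
  have hone : ∀ S ∈ patterns n k, (k : ℝ≥0∞) * p ≤
      ∑ i ∈ S, p * (L * Q (S.erase i) i + L⁻¹ * M) + ENNReal.ofReal (α * k) + k * μ (Er S) := by
    intro S hS
    have hSk : S.card = k := by simpa [patterns, Finset.mem_powersetCard_univ] using hS
    have h1 : ∀ i ∈ S, p ≤ p * (L * Q (S.erase i) i + L⁻¹ * M) +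
        (μ (sm i ∩ {ω | i ∉ est (obs n m J SNR k S ω)} ∩ (Er S)ᶜ) + μ (Er S)) := by
      intro i hi
      have h2 := omegaLaw_insert_le (τ := τ) (m := m) (J := J) (k := k) hSNR hs
        (Finset.notMem_erase i S) (hHm (S.erase i) i) L hL hL'
      rw [Finset.insert_erase hi] at h2
      rw [← hsmall i]
      calc μ (sm i) ≤ μ ({ω | (∀ j, |ω.1 j i| ≤ τ) ∧ obs n m J SNR k S ω ∈ H (S.erase i) i} ∪
            (sm i ∩ {ω | i ∉ est (obs n m J SNR k S ω)} ∩ (Er S)ᶜ ∪ Er S)) := by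
            refine measure_mono fun ω hω => ?_
            by_cases he : ω ∈ Er S
            · exact Or.inr (Or.inr he)
            by_cases hie : i ∈ est (obs n m J SNR k S ω)
            · refine Or.inl ⟨hω, hie, ?_⟩
              have h3 : ((est (obs n m J SNR k S ω) \ S).card : ℝ) ≤ α * k :=
                ((distor_le_iff hk).1 (not_lt.1 he)).2
              have h4 : est (obs n m J SNR k S ω) \ S.erase i ⊆
                  insert i (est (obs n m J SNR k S ω) \ S) := by
                intro l hl
                simp only [Finset.mem_sdiff, Finset.mem_erase, Finset.mem_insert] at hl ⊢
                tauto
              have h5 := (Finset.card_le_card h4).trans (Finset.card_insert_le _ _)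
              have h6 : ((est (obs n m J SNR k S ω) \ S.erase i).card : ℝ) ≤
                (est (obs n m J SNR k S ω) \ S).card + 1 := by exact_mod_cast h5
              linarith
            · exact Or.inr (Or.inl ⟨⟨hω, hie⟩, he⟩)
        _ ≤ _ := (measure_union_le _ _).trans (add_le_add
            (by rw [hsmall i]; exact h2) (measure_union_le _ _))
    have h7 : ∑ i ∈ S, μ (sm i ∩ {ω | i ∉ est (obs n m J SNR k S ω)} ∩ (Er S)ᶜ) ≤
        ENNReal.ofReal (α * k) := by
      refine sum_measure_le_of_count μ S _ (fun i => ((hsmm i).inter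
        (measurable_obs n m J SNR k S (hP fun T => i ∉ T))).inter (hErm S).compl) _ fun ω => ?_
      by_cases he : ω ∈ Er S
      · rw [Finset.filter_eq_empty_iff.2 fun i _ hi => hi.2 he, Finset.card_empty, Nat.cast_zero]
        positivity
      · refine le_trans ?_ ((distor_le_iff hk).1 (not_lt.1 he)).1
        refine Nat.cast_le.2 (Finset.card_le_card fun i hi => ?_)
        rw [Finset.mem_filter] at hi
        exact Finset.mem_sdiff.2 ⟨hi.1, hi.2.1.2⟩
    calc (k : ℝ≥0∞) * p = ∑ i ∈ S, p := by simp [hSk]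
      _ ≤ _ := Finset.sum_le_sum h1
      _ ≤ _ := by
        rw [Finset.sum_add_distrib, Finset.sum_add_distrib, ← add_assoc]
        gcongr
        simp [hSk]
  have hQsum : ∑ S ∈ patterns n k, ∑ i ∈ S, Q (S.erase i) i ≤
      n.choose (k - 1) * ENNReal.ofReal (α * k + 1) := by
    rw [sum_patterns_erase hk]
    calc _ ≤ ∑ S ∈ patterns n (k - 1), ENNReal.ofReal (α * k + 1) := by
          refine Finset.sum_le_sum fun S _ => ?_
          refine sum_measure_le_of_count μ Sᶜ _ (fun i => measurable_obs n m J SNR k S (hHm S i)) _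
            fun ω => ?_
          by_cases hc : ((est (obs n m J SNR k S ω) \ S).card : ℝ) ≤ α * k + 1
          · refine le_trans (Nat.cast_le.2 (Finset.card_le_card fun i hi => ?_)) hc
            rw [Finset.mem_filter] at hi
            exact Finset.mem_sdiff.2 ⟨hi.2.1, Finset.mem_compl.1 hi.1⟩
          · rw [Finset.filter_eq_empty_iff.2 fun i _ hi => hc hi.2, Finset.card_empty,
              Nat.cast_zero]
            positivity
      _ = _ := by simp [patterns]
  have hcard : (patterns n k).card = n.choose k := by simp [patterns]
  calc (n.choose k : ℝ≥0∞) * (k * p) = ∑ S ∈ patterns n k, k * p := by simp [hcard]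
    _ ≤ _ := Finset.sum_le_sum hone
    _ = p * (L * ∑ S ∈ patterns n k, ∑ i ∈ S, Q (S.erase i) i +
          ∑ S ∈ patterns n k, ∑ i ∈ S, L⁻¹ * M) + n.choose k * ENNReal.ofReal (α * k) +
        k * ∑ S ∈ patterns n k, μ (Er S) := by
      simp only [Finset.sum_add_distrib, Finset.mul_sum, mul_add]
      rw [Finset.sum_const, hcard, nsmul_eq_mul]
    _ ≤ _ := by
      gcongr
      calc ∑ S ∈ patterns n k, ∑ i ∈ S, L⁻¹ * M = ∑ S ∈ patterns n k, k * (L⁻¹ * M) := by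
            refine Finset.sum_congr rfl fun S hS => ?_
            have hSk : S.card = k := by simpa [patterns, Finset.mem_powersetCard_univ] using hS
            simp [hSk]
        _ ≤ _ := by simp [hcard]

lemma converse_finite {n m J k : ℕ} (hk : 1 ≤ k) (hkn : k ≤ n) {SNR τ α : ℝ} (hSNR : 0 ≤ SNR)
    (hα : 0 ≤ α) (hs : SNR / k * τ ^ 2 ≤ 1 / 4) (est : Estimator n m J) {L : ℝ} (hL : 0 < L) :
    ((n : ℝ) - k + 1) * ((stdGaussian {x | |x| ≤ τ}) ^ J).toReal ≤
      ((stdGaussian {x | |x| ≤ τ}) ^ J).toReal *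
        (L * (α * k + 1) +
          ((n : ℝ) - k + 1) * (L⁻¹ * exp (2 * (SNR / k * τ ^ 2) * (m * J)))) +
      ((n : ℝ) - k + 1) * (α + errProb n m J k SNR α est) := by
  set p := (stdGaussian {x | |x| ≤ τ}) ^ J with hp
  have hp' : p ≠ ⊤ := ENNReal.pow_ne_top (measure_ne_top _ _)
  set e := errProb n m J k SNR α est with he
  set M := exp (2 * (SNR / k * τ ^ 2) * (m * J))
  have hd : (0 : ℝ) < (n : ℝ) - k + 1 := by
    have : (k : ℝ) ≤ n := by exact_mod_cast hkn
    linarith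
  have hN' : (0 : ℝ) < n.choose (k - 1) := by
    exact_mod_cast Nat.choose_pos (by omega)
  have hN : (0 : ℝ) < n.choose k := by exact_mod_cast Nat.choose_pos hkn
  have hrec : (n.choose k : ℝ) * k = n.choose (k - 1) * ((n : ℝ) - k + 1) := by
    have h := Nat.choose_succ_right_eq n (k - 1)
    rw [Nat.sub_add_cancel hk] at h
    have h2 : ((n - (k - 1) : ℕ) : ℝ) = (n : ℝ) - k + 1 := by
      rw [Nat.cast_sub (by omega), Nat.cast_sub hk]; push_cast; ring
    rw [← h2]
    exact_mod_cast h
  refine le_of_forall_pos_le_add fun ε hε => ?_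
  set δ := ε / ((n : ℝ) - k + 1) with hδ
  have hδ0 : 0 < δ := by positivity
  obtain ⟨est', hm, hle⟩ := exists_measurable_estimator (m := m) (J := J) (k := k) SNR α est
    (ε := ENNReal.ofReal δ) (by simpa using hδ0)
  have hcount := counting_le hk hSNR hα hs est' hm (ENNReal.ofReal L) (by simpa using hL)
    ENNReal.ofReal_ne_top
  set a : Finset (Fin n) → ℝ≥0∞ := fun S => omegaLaw n m J
    {ω | α < distor k S (est (Yobs n m J SNR k S ω) ω.2.1)} with ha
  have hsum : ∑ S ∈ patterns n k, omegaLaw n m J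
      {ω | α < distor k S (est' (obs n m J SNR k S ω))} ≤
      ENNReal.ofReal (n.choose k * e + n.choose k * δ) := by
    calc _ ≤ ∑ S ∈ patterns n k, (a S + ENNReal.ofReal δ) := Finset.sum_le_sum fun S _ => hle S
      _ = ∑ S ∈ patterns n k, ENNReal.ofReal ((a S).toReal + δ) := by
        refine Finset.sum_congr rfl fun S _ => ?_
        rw [ENNReal.ofReal_add ENNReal.toReal_nonneg hδ0.le,
          ENNReal.ofReal_toReal (measure_ne_top _ _)]
      _ = ENNReal.ofReal (∑ S ∈ patterns n k, ((a S).toReal + δ)) :=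
        (ENNReal.ofReal_sum_of_nonneg fun S _ => by positivity).symm
      _ = _ := by
        congr 1
        rw [Finset.sum_add_distrib]
        congr 1
        · rw [he, errProb, mul_inv_cancel_left₀ hN.ne']
        · simp [patterns]
  have he0 : 0 ≤ e := by
    rw [he, errProb]
    exact mul_nonneg (by positivity) (Finset.sum_nonneg fun _ _ => ENNReal.toReal_nonneg)
  have h1 := hcount.trans (add_le_add_right (mul_le_mul_right hsum _) _)
  have hM : (0 : ℝ) ≤ M := (exp_pos _).le
  rw [← hp, ← ENNReal.ofReal_toReal hp', ← ENNReal.ofReal_inv_of_pos hL] at h1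
  simp only [← ENNReal.ofReal_natCast] at h1
  have hP : 0 ≤ p.toReal := ENNReal.toReal_nonneg
  repeat' (first
    | rw [← ENNReal.ofReal_mul (by positivity)] at h1
    | rw [← ENNReal.ofReal_add (by positivity) (by positivity)] at h1)
  rw [ENNReal.ofReal_le_ofReal_iff (by positivity)] at h1
  refine le_of_mul_le_mul_left ?_ hN'
  have hδd : δ * ((n : ℝ) - k + 1) = ε := by rw [hδ]; field_simp
  calc (n.choose (k - 1) : ℝ) * (((n : ℝ) - k + 1) * p.toReal)
      = n.choose k * (k * p.toReal) := by linear_combination (-p.toReal) * hrec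
    _ ≤ _ := h1
    _ = _ := by
      linear_combination (p.toReal * (L⁻¹ * M) + α + e + δ) * hrec + (n.choose (k - 1) : ℝ) * hδd

lemma converse_limit {J : ℕ} {κ SNR ρ α τ L : ℝ} (hκ : κ ∈ Set.Ioo (0 : ℝ) (1 / 2))
    (hSNR : 0 ≤ SNR) (hα : 0 ≤ α) (hL : 0 < L) (h : achievable κ SNR ρ J α) :
    (1 - κ) * ((stdGaussian {x | |x| ≤ τ}) ^ J).toReal ≤
      ((stdGaussian {x | |x| ≤ τ}) ^ J).toReal *
        (L * (α * κ) + (1 - κ) * (L⁻¹ * exp (2 * (SNR * τ ^ 2 * ρ / κ)))) + (1 - κ) * α := by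
  obtain ⟨k, m, est, hk, hm, he⟩ := h
  have hn : Tendsto (fun n : ℕ => (n : ℝ)) atTop atTop := tendsto_natCast_atTop_atTop
  have hinv : Tendsto (fun n : ℕ => 1 / (n : ℝ)) atTop (𝓝 0) :=
    tendsto_const_nhds.div_atTop hn
  have hkinf : Tendsto (fun n => (k n : ℝ)) atTop atTop := by
    have h1 := hk.pos_mul_atTop hκ.1 hn
    refine h1.congr' ?_
    filter_upwards [eventually_gt_atTop 0] with n hn0
    have : (n : ℝ) ≠ 0 := by exact_mod_cast hn0.ne'
    field_simp
  set P := ((stdGaussian {x | |x| ≤ τ}) ^ J).toReal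
  have hd : Tendsto (fun n : ℕ => 1 - (k n : ℝ) / n + 1 / n) atTop (𝓝 (1 - κ + 0)) :=
    (tendsto_const_nhds.sub hk).add hinv
  rw [add_zero] at hd
  have hs : Tendsto (fun n : ℕ => SNR / k n * τ ^ 2) atTop (𝓝 (0 * τ ^ 2)) :=
    (tendsto_const_nhds.div_atTop hkinf).mul_const _
  rw [zero_mul] at hs
  have hE : Tendsto (fun n : ℕ => exp (2 * (SNR * τ ^ 2 * ((J : ℝ) * m n / n) / (k n / n)))) atTop
      (𝓝 (exp (2 * (SNR * τ ^ 2 * ρ / κ)))) :=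
    (Real.continuous_exp.tendsto _).comp (((hm.const_mul _).div hk hκ.1.ne').const_mul _)
  have hrhs : Tendsto (fun n : ℕ => P * (L * (α * (k n / n) + 1 / n) + (1 - (k n : ℝ) / n + 1 / n) *
      (L⁻¹ * exp (2 * (SNR * τ ^ 2 * ((J : ℝ) * m n / n) / (k n / n))))) +
      (1 - (k n : ℝ) / n + 1 / n) * (α + errProb n (m n) J (k n) SNR α (est n))) atTop
      (𝓝 (P * (L * (α * κ + 0) + (1 - κ) * (L⁻¹ * exp (2 * (SNR * τ ^ 2 * ρ / κ)))) +
        (1 - κ) * (α + 0))) :=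
    (((((hk.const_mul _).add hinv).const_mul _).add (hd.mul (hE.const_mul _))).const_mul _).add
      (hd.mul (he.const_add _))
  rw [add_zero, add_zero] at hrhs
  refine le_of_tendsto_of_tendsto (hd.mul_const P) hrhs ?_
  filter_upwards [eventually_gt_atTop 0, hkinf.eventually_ge_atTop 1,
    hs.eventually (eventually_le_nhds (show (0 : ℝ) < 1 / 4 by norm_num)),
    hk.eventually (eventually_le_nhds (show κ < 1 by linarith [hκ.2]))] with n hn0 hk1 hs1 hkn
  have hn0' : (0 : ℝ) < n := by exact_mod_cast hn0
  have hkn' : k n ≤ n := by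
    rw [div_le_one hn0'] at hkn; exact_mod_cast hkn
  have hk0 : (0 : ℝ) < k n := by linarith
  have hfin := converse_finite (m := m n) (by exact_mod_cast hk1) hkn' hSNR hα hs1 (est n) hL
  have harg : 2 * (SNR * τ ^ 2 * ((J : ℝ) * m n / n) / (k n / n)) =
      2 * (SNR / k n * τ ^ 2) * (m n * J) := by field_simp
  rw [harg]
  refine le_of_mul_le_mul_left ?_ hn0'
  refine le_trans (le_of_eq ?_) (hfin.trans (le_of_eq ?_))
  · field_simp; ring
  · simp only [P]; field_simp

lemma converse_rate {J : ℕ} (hJ : 1 ≤ J) {κ SNR ρ α : ℝ} (hκ : κ ∈ Set.Ioo (0 : ℝ) (1 / 2))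
    (hSNR : 0 < SNR) (hα : 0 < α) (hα' : α ≤ 1 / 256) (hαJ : 2 * α ≤ (1 / 4) ^ J)
    (h : achievable κ SNR ρ J α) :
    κ / (64 * SNR * 2 ^ ((2 : ℝ) / J)) * (1 / α) ^ ((2 : ℝ) / J) * Real.log (1 / α) ≤ ρ := by
  obtain ⟨hκ0, hκ1⟩ := hκ
  set y := (2 * α) ^ ((J : ℝ)⁻¹) with hy
  have hJ0 : J ≠ 0 := by omega
  have hJr : (0 : ℝ) < J := by exact_mod_cast hJ
  have hy0 : 0 < y := by positivity
  have hyJ : y ^ J = 2 * α := Real.rpow_inv_natCast_pow (by positivity) hJ0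
  have hy1 : y ≤ 1 / 4 := by
    refine le_of_pow_le_pow_left₀ hJ0 (by norm_num) ?_
    rw [hyJ]; exact hαJ
  set P := ((stdGaussian {x | |x| ≤ 4 * y}) ^ J).toReal with hP
  have hP2 : 2 * α ≤ P := by
    have h1 := le_gaussian_small_ball (τ := 4 * y) (by linarith)
    have h2 : ENNReal.ofReal (2 * α) ≤ (stdGaussian {x | |x| ≤ 4 * y}) ^ J := by
      rw [← hyJ, ENNReal.ofReal_pow hy0.le]
      refine pow_le_pow_left' ?_ J
      rwa [mul_div_cancel_left₀ y (by norm_num : (4 : ℝ) ≠ 0)] at h1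
    exact (ENNReal.ofReal_le_iff_le_toReal (ENNReal.pow_ne_top (measure_ne_top _ _))).1 h2
  set L := (1 - κ) / (4 * α * κ) with hL
  have hL0 : 0 < L := by
    rw [hL]; have : 0 < 1 - κ := by linarith
    positivity
  have hmain := converse_limit (τ := 4 * y) ⟨hκ0, hκ1⟩ hSNR.le hα.le hL0 h
  rw [← hP] at hmain
  set M := exp (2 * (SNR * (4 * y) ^ 2 * ρ / κ)) with hM
  have hLακ : L * (α * κ) = (1 - κ) / 4 := by rw [hL]; field_simp
  rw [hLακ] at hmain
  have hP0 : 0 < P := by linarith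
  have h3 : 1 / 4 ≤ L⁻¹ * M := by
    have h4 : (1 - κ) * P * (1 / 4) ≤ (1 - κ) * P * (L⁻¹ * M) := by nlinarith
    exact le_of_mul_le_mul_left h4 (mul_pos (by linarith) hP0)
  have h5 : 1 / (16 * α) ≤ M := by
    have h6 : L / 4 ≤ M := by
      rw [inv_mul_eq_div, le_div_iff₀ hL0] at h3; linarith
    refine le_trans ?_ h6
    rw [hL, div_div, div_le_div_iff₀ (by positivity) (by positivity)]
    nlinarith
  have h7 : Real.log (1 / (16 * α)) ≤ 2 * (SNR * (4 * y) ^ 2 * ρ / κ) := by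
    rw [hM] at h5
    exact (Real.log_le_iff_le_exp (by positivity)).2 h5
  have h8 : Real.log (1 / α) / 2 ≤ Real.log (1 / (16 * α)) := by
    have h9 : 0 ≤ Real.log (1 / (256 * α)) := Real.log_nonneg (by
      rw [le_div_iff₀ (by positivity)]; linarith)
    have h10 : 2 * Real.log (1 / (16 * α)) = Real.log (1 / (256 * α)) + Real.log (1 / α) := by
      rw [← Real.log_mul (by positivity) (by positivity), ← Nat.cast_two, ← Real.log_pow]
      congr 1; field_simp; norm_num
    linarith
  have hy2 : y ^ 2 = 2 ^ ((2 : ℝ) / J) / (1 / α) ^ ((2 : ℝ) / J) := by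
    rw [hy, ← Real.rpow_natCast, ← Real.rpow_mul (by positivity),
      ← Real.div_rpow (by norm_num) (by positivity)]
    congr 1
    · field_simp
    · push_cast; field_simp
  have h11 : Real.log (1 / α) * κ ≤ 64 * SNR * y ^ 2 * ρ := by
    have := h8.trans h7
    rw [← mul_div_assoc, div_le_div_iff₀ (by norm_num) hκ0] at this
    linarith
  rw [hy2] at h11
  have hB : 0 < (2 : ℝ) ^ ((2 : ℝ) / J) := by positivity
  have hA : 0 < (1 / α) ^ ((2 : ℝ) / J) := by positivity
  generalize (2 : ℝ) ^ ((2 : ℝ) / J) = B at *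
  generalize (1 / α) ^ ((2 : ℝ) / J) = A at *
  rw [← mul_le_mul_iff_right₀ (show 0 < 64 * SNR * (B / A) by positivity)]
  refine le_trans (le_of_eq ?_) h11
  field_simp

lemma row_energy_tail {n m : ℕ} (z : Fin n → ℝ) {b l : ℝ} (hz : ∑ i, z i ^ 2 + 1 ≤ 4 * b ^ 2)
    (hl : |l| * (4 * b ^ 2) ≤ 1 / 4) (η : ℝ) :
    (Measure.pi fun _ : Fin m => (gaussianPi (Fin n)).prod stdGaussian)
      {p | m * η ≤ l * (∑ r, (∑ i, (p r).1 i * z i + (p r).2) ^ 2 - m * (∑ i, z i ^ 2 + 1))} ≤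
      ENNReal.ofReal (exp (m * (4 * (l * (4 * b ^ 2)) ^ 2 - η))) := by
  have hv : ((∑ i, ‖z i‖₊ ^ 2 + 1 : ℝ≥0) : ℝ) = ∑ i, z i ^ 2 + 1 := by
    push_cast
    simp
  have hv0 : 0 ≤ ∑ i, z i ^ 2 := Finset.sum_nonneg fun i _ => sq_nonneg _
  have h := chernoff_rows (m := m) (l := l) (η := η) ((gaussianPi (Fin n)).prod stdGaussian)
    (fun p : (Fin n → ℝ) × ℝ => ∑ i, p.1 i * z i + p.2) (by fun_prop) _ (map_row z)
    (by rw [hv]; exact (mul_le_mul_of_nonneg_left hz (abs_nonneg l)).trans hl)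
  rw [hv] at h
  refine h.trans (ENNReal.ofReal_le_ofReal (Real.exp_le_exp.2 ?_))
  have h2 : (l * (∑ i, z i ^ 2 + 1)) ^ 2 ≤ (l * (4 * b ^ 2)) ^ 2 := by
    rw [mul_pow, mul_pow]; gcongr
  gcongr

lemma correlation_tail {n m : ℕ} (x v : Fin n → ℝ) {b q t : ℝ} (hb : 0 < b) (hq : 0 < q)
    (ht : 0 ≤ t) (hx : 2 * ∑ i, x i ^ 2 + 1 ≤ 2 * b ^ 2) (hv : ∑ i, v i ^ 2 = q)
    (htq : t * √q ≤ 4 * b) :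
    (Measure.pi fun _ : Fin m => (gaussianPi (Fin n)).prod stdGaussian)
      {p | m * (t * q) ≤ ∑ r, (∑ i, (p r).1 i * v i) * (∑ i, (p r).1 i * x i + (p r).2) -
        m * ∑ i, v i * x i} ≤
      2 * ENNReal.ofReal (exp (-(m * (t ^ 2 * q / (64 * b ^ 2))))) := by
  set c := b / √q with hc
  have hsq : 0 < √q := Real.sqrt_pos.2 hq
  have hsq2 : √q ^ 2 = q := Real.sq_sqrt hq.le
  have hc0 : 0 < c := by positivity
  have hcq : c ^ 2 * q = b ^ 2 := by rw [hc, div_pow, hsq2]; field_simp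
  have hcross : ∀ s : ℝ, ∑ i, (x i + s * v i) ^ 2 =
      ∑ i, x i ^ 2 + 2 * s * ∑ i, v i * x i + s ^ 2 * q := by
    intro s
    rw [← hv, Finset.mul_sum, Finset.mul_sum, ← Finset.sum_add_distrib, ← Finset.sum_add_distrib]
    exact Finset.sum_congr rfl fun i _ => by ring
  have hplus := hcross c
  have hminus := hcross (-c)
  have hz : ∀ s : ℝ, s ^ 2 = c ^ 2 → ∑ i, (x i + s * v i) ^ 2 + 1 ≤ 4 * b ^ 2 := by
    intro s hs
    have h1 : ∑ i, (x i + s * v i) ^ 2 ≤ ∑ i, (2 * x i ^ 2 + 2 * (s ^ 2 * v i ^ 2)) :=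
      Finset.sum_le_sum fun i _ => by nlinarith [sq_nonneg (x i - s * v i)]
    rw [Finset.sum_add_distrib, ← Finset.mul_sum, ← Finset.mul_sum, ← Finset.mul_sum, hv, hs,
      hcq] at h1
    linarith
  set l := t * √q / (64 * b ^ 3) with hl
  have hl0 : 0 ≤ l := by positivity
  have hl1 : l * (4 * b ^ 2) ≤ 1 / 4 := by
    have : l * (4 * b ^ 2) = t * √q / (16 * b) := by rw [hl]; field_simp; ring
    rw [this, div_le_div_iff₀ (by positivity) (by norm_num)]; linarith
  set η := l * (2 * c * (t * q)) with hη
  have hexp : 4 * (l * (4 * b ^ 2)) ^ 2 - η = -(t ^ 2 * q / (64 * b ^ 2)) := by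
    have h1 : c * q = b * √q := by rw [hc]; nth_rw 2 [← hsq2]; field_simp
    have h2 : η = l * (2 * t * (b * √q)) := by rw [hη, ← h1]; ring
    rw [h2, hl]
    field_simp
    rw [hsq2]; ring
  have h1 := row_energy_tail (m := m) (fun i => x i + c * v i) (b := b) (l := l) (hz c rfl)
    (by rwa [abs_of_nonneg hl0]) η
  have h2 := row_energy_tail (m := m) (fun i => x i + -c * v i) (b := b) (l := -l)
    (hz (-c) (by ring)) (by rwa [abs_neg, abs_of_nonneg hl0]) η
  rw [neg_mul, neg_sq] at h2
  rw [hexp, mul_neg] at h1 h2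
  rw [two_mul]
  refine le_trans (measure_mono ?_) ((measure_union_le _ _).trans (add_le_add h1 h2))
  intro p hp
  simp only [Set.mem_union, Set.mem_ofPred_eq] at hp ⊢
  by_contra! hcon
  obtain ⟨hc1, hc2⟩ := hcon
  have hsplit : ∀ (s : ℝ) r, ∑ i, (p r).1 i * (x i + s * v i) =
      ∑ i, (p r).1 i * x i + s * ∑ i, (p r).1 i * v i := by
    intro s r
    rw [Finset.mul_sum, ← Finset.sum_add_distrib]
    exact Finset.sum_congr rfl fun i _ => by ring
  simp only [hsplit] at hc1 hc2
  rw [hplus] at hc1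
  rw [hminus] at hc2
  have hpol : ∑ r, (∑ i, (p r).1 i * x i + c * ∑ i, (p r).1 i * v i + (p r).2) ^ 2 -
      ∑ r, (∑ i, (p r).1 i * x i + -c * ∑ i, (p r).1 i * v i + (p r).2) ^ 2 =
      4 * c * ∑ r, (∑ i, (p r).1 i * v i) * (∑ i, (p r).1 i * x i + (p r).2) := by
    rw [← Finset.sum_sub_distrib, Finset.mul_sum]
    exact Finset.sum_congr rfl fun r _ => by ring
  have h3 := add_lt_add hc1 hc2
  have h4 : l * (4 * c) * (m * (t * q)) ≤ l * (4 * c) *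
      (∑ r, (∑ i, (p r).1 i * v i) * (∑ i, (p r).1 i * x i + (p r).2) - m * ∑ i, v i * x i) :=
    mul_le_mul_of_nonneg_left hp (by positivity)
  rw [hη] at h3
  have h5 : (0 : ℝ) < 0 := by linear_combination h3 + h4 - l * hpol
  exact lt_irrefl _ h5

lemma measure_many_small_le {n m J k q : ℕ} {τ : ℝ} {S : Finset (Fin n)} (hS : S.card = k) :
    omegaLaw n m J {ω | q ≤ (S.filter fun i => ∀ j, |ω.1 j i| < τ).card} ≤
      k.choose q * ENNReal.ofReal τ ^ (q * J) := by
  classical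
  set B : Finset (Fin n) → Set (Omega n m J) := fun F => {ω | ∀ j, ∀ i ∈ F, |ω.1 j i| ≤ τ} with hB
  have hsub : {ω : Omega n m J | q ≤ (S.filter fun i => ∀ j, |ω.1 j i| < τ).card} ⊆
      ⋃ F ∈ S.powersetCard q, B F := by
    intro ω hω
    obtain ⟨F, hF, hFq⟩ := Finset.exists_subset_card_eq hω
    refine Set.mem_biUnion (x := F) (Finset.mem_powersetCard.2
      ⟨hF.trans (Finset.filter_subset _ _), hFq⟩) fun j i hi => ?_
    exact ((Finset.mem_filter.1 (hF hi)).2 j).le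
  have hBF : ∀ F ∈ S.powersetCard q, omegaLaw n m J (B F) ≤ ENNReal.ofReal τ ^ (q * J) := by
    intro F hF
    have hms : MeasurableSet {x : ℝ | |x| ≤ τ} := measurableSet_le (by fun_prop) (by fun_prop)
    set R : Set (Fin J → Fin n → ℝ) :=
      Set.univ.pi fun _ => Set.univ.pi fun i => if i ∈ F then {x | |x| ≤ τ} else Set.univ
    have hR : MeasurableSet R := by
      refine MeasurableSet.univ_pi fun _ => MeasurableSet.univ_pi fun i => ?_
      split_ifs
      exacts [hms, MeasurableSet.univ]
    have h1 : MeasurePreserving (fun ω : Omega n m J => ω.1) (omegaLaw n m J)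
        (Measure.pi fun _ : Fin J => gaussianPi (Fin n)) := measurePreserving_fst
    have h2 : B F = (fun ω : Omega n m J => ω.1) ⁻¹' R := by
      ext ω
      simp only [hB, R, Set.mem_ofPred_eq, Set.mem_preimage, Set.mem_pi, Set.mem_univ,
        true_imp_iff]
      refine forall_congr' fun j => forall_congr' fun i => ?_
      by_cases hi : i ∈ F <;> simp [hi]
    rw [h2, h1.measure_preimage hR.nullMeasurableSet, Measure.pi_pi]
    have h3 : gaussianPi (Fin n)
        (Set.univ.pi fun i => if i ∈ F then {x : ℝ | |x| ≤ τ} else Set.univ) ≤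
        ENNReal.ofReal τ ^ q := by
      unfold gaussianPi
      rw [Measure.pi_pi]
      calc ∏ i, stdGaussian (if i ∈ F then {x : ℝ | |x| ≤ τ} else Set.univ)
          = ∏ i, if i ∈ F then stdGaussian {x : ℝ | |x| ≤ τ} else 1 := by
            refine Finset.prod_congr rfl fun i _ => ?_
            split_ifs <;> simp
        _ = stdGaussian {x : ℝ | |x| ≤ τ} ^ q := by
            rw [Finset.prod_ite_mem, Finset.univ_inter, Finset.prod_const,
              (Finset.mem_powersetCard.1 hF).2]
        _ ≤ _ := pow_le_pow_left' (gaussian_small_ball_le τ) q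
    simp only [Finset.prod_const, Finset.card_univ, Fintype.card_fin]
    rw [pow_mul]
    exact pow_le_pow_left' h3 J
  calc _ ≤ ∑ F ∈ S.powersetCard q, omegaLaw n m J (B F) :=
        (measure_mono hsub).trans (measure_biUnion_finset_le _ _)
    _ ≤ ∑ F ∈ S.powersetCard q, ENNReal.ofReal τ ^ (q * J) := Finset.sum_le_sum hBF
    _ = _ := by simp [hS]

lemma measure_large_energy_le {n m J k : ℕ} {S : Finset (Fin n)} (hS : S.card = k) (j : Fin J) :
    omegaLaw n m J {ω | 2 * (k : ℝ) < ∑ i ∈ S, ω.1 j i ^ 2} ≤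
      ENNReal.ofReal (exp (-(k / 16))) := by
  classical
  have h1 : MeasurePreserving (fun ω : Omega n m J => ω.1 j) (omegaLaw n m J)
      (gaussianPi (Fin n)) :=
    (measurePreserving_eval (fun _ : Fin J => gaussianPi (Fin n)) j).comp measurePreserving_fst
  have hset : {ω : Omega n m J | 2 * (k : ℝ) < ∑ i ∈ S, ω.1 j i ^ 2} =
      (fun ω : Omega n m J => ω.1 j) ⁻¹' {x | 2 * (k : ℝ) < ∑ i ∈ S, x i ^ 2} := rfl
  rw [hset, h1.measure_preimage
    (measurableSet_lt (by fun_prop) (by fun_prop)).nullMeasurableSet]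
  set f : Fin n → ℝ → ℝ≥0∞ := fun i y =>
    if i ∈ S then ENNReal.ofReal (exp (1 / 8 * (y ^ 2 - 1))) else 1 with hf
  have hfm : ∀ i, Measurable (f i) := fun i => by
    by_cases hi : i ∈ S <;> simp only [hf, hi, if_true, if_false] <;> fun_prop
  have h_integral : ∫⁻ x, ∏ i, f i (x i) ∂(gaussianPi (Fin n)) ≤ ENNReal.ofReal (exp (k / 16)) := by
    unfold gaussianPi
    rw [lintegral_pi_prod (fun _ => stdGaussian) f hfm]
    calc ∏ i, ∫⁻ y, f i y ∂stdGaussian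
        ≤ ∏ i, if i ∈ S then ENNReal.ofReal (exp (1 / 16)) else 1 := by
          refine Finset.prod_le_prod' fun i _ => ?_
          by_cases hi : i ∈ S
          · simp only [hf, hi, if_true]
            refine (lintegral_exp_sq_stdGaussian_le (by norm_num)).trans_eq ?_
            norm_num
          · simp [hf, hi]
      _ = _ := by
          rw [Finset.prod_ite_mem, Finset.univ_inter, Finset.prod_const, hS,
            ← ENNReal.ofReal_pow (exp_pos _).le, ← Real.exp_nat_mul]
          congr 2; ring
  have hpt : ∀ x : Fin n → ℝ, ∏ i, f i (x i) =
      ENNReal.ofReal (exp (1 / 8 * (∑ i ∈ S, x i ^ 2 - k))) := by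
    intro x
    simp only [hf]
    rw [Finset.prod_ite_mem, Finset.univ_inter,
      ← ENNReal.ofReal_prod_of_nonneg fun _ _ => (exp_pos _).le, ← Real.exp_sum,
      ← Finset.mul_sum, Finset.sum_sub_distrib]
    simp [hS]
  have hmark := mul_meas_ge_le_lintegral (μ := gaussianPi (Fin n))
    (f := fun x => ∏ i, f i (x i)) (Finset.measurable_prod _ fun i _ =>
      (hfm i).comp (measurable_pi_apply i)) (ENNReal.ofReal (exp (k / 8)))
  have hle : ENNReal.ofReal (exp (k / 8)) * gaussianPi (Fin n) {x | 2 * (k : ℝ) < ∑ i ∈ S, x i ^ 2}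
      ≤ ENNReal.ofReal (exp (k / 16)) := by
    refine le_trans ?_ (hmark.trans h_integral)
    gcongr with x
    intro hx
    rw [hpt]
    refine ENNReal.ofReal_le_ofReal (Real.exp_le_exp.2 ?_)
    have : 2 * (k : ℝ) < ∑ i ∈ S, x i ^ 2 := hx
    linarith
  calc _ = ENNReal.ofReal (exp (-(k / 8))) * (ENNReal.ofReal (exp (k / 8)) *
        gaussianPi (Fin n) {x | 2 * (k : ℝ) < ∑ i ∈ S, x i ^ 2}) := by
        rw [← mul_assoc, ← ENNReal.ofReal_mul (exp_pos _).le, ← Real.exp_add]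
        simp
    _ ≤ ENNReal.ofReal (exp (-(k / 8))) * ENNReal.ofReal (exp (k / 16)) := by gcongr
    _ = _ := by
        rw [← ENNReal.ofReal_mul (exp_pos _).le, ← Real.exp_add]
        congr 2; ring

lemma measurePreserving_rows {n m J : ℕ} (j : Fin J) :
    MeasurePreserving (fun (p : (Fin J → Fin m → Fin n → ℝ) × (Fin J → Fin m → ℝ)) (r : Fin m) =>
        (p.1 j r, p.2 j r))
      ((Measure.pi fun _ : Fin J => Measure.pi fun _ : Fin m => gaussianPi (Fin n)).prod
        (Measure.pi fun _ : Fin J => gaussianPi (Fin m)))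
      (Measure.pi fun _ : Fin m => (gaussianPi (Fin n)).prod stdGaussian) :=
  (measurePreserving_arrowProdEquivProdArrow (Fin n → ℝ) ℝ (Fin m)
      (fun _ => gaussianPi (Fin n)) (fun _ => stdGaussian)).symm.comp
    ((measurePreserving_eval (fun _ : Fin J => Measure.pi fun _ : Fin m => gaussianPi (Fin n)) j).prod
      (measurePreserving_eval (fun _ : Fin J => gaussianPi (Fin m)) j))

/-- Error of the matched filter at index `i` of the `j`-th signal (scaled by the number `m` of
measurements). -/
def filterError (n m J : ℕ) (SNR : ℝ) (k : ℕ) (S : Finset (Fin n)) (ω : Omega n m J) (j : Fin J)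
    (i : Fin n) : ℝ :=
  ∑ r, ω.2.1 j r i * Yobs n m J SNR k S ω j r - m * (√(SNR / k) * signal n S (ω.1 j) i)

lemma sum_mul_filterError {n m J k : ℕ} {SNR : ℝ} {S : Finset (Fin n)} (ω : Omega n m J)
    (j : Fin J) (v : Fin n → ℝ) :
    ∑ i, v i * filterError n m J SNR k S ω j i =
      ∑ r, (∑ i, ω.2.1 j r i * v i) * (∑ i, ω.2.1 j r i * (√(SNR / k) * signal n S (ω.1 j) i) +
        ω.2.2 j r) - m * ∑ i, v i * (√(SNR / k) * signal n S (ω.1 j) i) := by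
  simp only [filterError, mul_sub, Finset.sum_sub_distrib]
  congr 1
  · simp_rw [Finset.mul_sum]
    rw [Finset.sum_comm]
    refine Finset.sum_congr rfl fun r _ => ?_
    rw [Finset.sum_mul]
    refine Finset.sum_congr rfl fun i _ => ?_
    have : Yobs n m J SNR k S ω j r =
        ∑ i, ω.2.1 j r i * (√(SNR / k) * signal n S (ω.1 j) i) + ω.2.2 j r := by
      unfold Yobs
      rw [Finset.mul_sum]
      congr 1
      exact Finset.sum_congr rfl fun i _ => by ring
    rw [this]; ring
  · rw [Finset.mul_sum]
    exact Finset.sum_congr rfl fun i _ => by ring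

lemma sum_signal_sq {n : ℕ} (S : Finset (Fin n)) (x : Fin n → ℝ) (c : ℝ) :
    ∑ i, (c * signal n S x i) ^ 2 = c ^ 2 * ∑ i ∈ S, x i ^ 2 := by
  have : ∀ i, (c * signal n S x i) ^ 2 = if i ∈ S then c ^ 2 * x i ^ 2 else 0 := fun i => by
    unfold signal; split_ifs <;> ring
  simp_rw [this]
  rw [Finset.sum_ite_mem, Finset.univ_inter, Finset.mul_sum]

lemma measure_filterError_sum_le {n m J k : ℕ} {SNR t b q : ℝ} (hSNR : 0 ≤ SNR) (hb : 0 < b)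
    (hb2 : b ^ 2 = 1 + 2 * SNR) (hq : 0 < q) (ht : 0 ≤ t) (htq : t * √q ≤ 4 * b) (hk : 1 ≤ k)
    (S : Finset (Fin n)) (j : Fin J) (v : Fin n → ℝ) (hv : ∑ i, v i ^ 2 = q) :
    omegaLaw n m J {ω | ∑ i ∈ S, ω.1 j i ^ 2 ≤ 2 * k ∧
      m * (t * q) ≤ ∑ i, v i * filterError n m J SNR k S ω j i} ≤
      2 * ENNReal.ofReal (exp (-(m * (t ^ 2 * q / (64 * b ^ 2))))) := by
  have hk0 : (0 : ℝ) < k := by exact_mod_cast hk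
  have hms : MeasurableSet {ω : Omega n m J | ∑ i ∈ S, ω.1 j i ^ 2 ≤ 2 * k ∧
      m * (t * q) ≤ ∑ i, v i * filterError n m J SNR k S ω j i} := by
    have hY : ∀ r, Measurable fun ω : Omega n m J => Yobs n m J SNR k S ω j r := fun r =>
      (measurable_pi_apply r).comp ((measurable_pi_apply j).comp
        (measurable_fst.comp (measurable_obs n m J SNR k S)))
    have hsig : ∀ i, Measurable fun ω : Omega n m J => signal n S (ω.1 j) i := fun i => by
      unfold signal; split_ifs <;> fun_prop
    have hfe : ∀ i, Measurable fun ω : Omega n m J => filterError n m J SNR k S ω j i := by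
      unfold filterError; fun_prop
    have h1 : MeasurableSet {ω : Omega n m J | ∑ i ∈ S, ω.1 j i ^ 2 ≤ 2 * k} :=
      measurableSet_le (by fun_prop) (by fun_prop)
    have h2 : MeasurableSet {ω : Omega n m J |
        m * (t * q) ≤ ∑ i, v i * filterError n m J SNR k S ω j i} :=
      measurableSet_le (by fun_prop) (by fun_prop)
    exact h1.inter h2
  unfold omegaLaw
  rw [Measure.prod_apply hms]
  calc _ ≤ ∫⁻ _, 2 * ENNReal.ofReal (exp (-(m * (t ^ 2 * q / (64 * b ^ 2)))))
        ∂(Measure.pi fun _ : Fin J => gaussianPi (Fin n)) := by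
        refine lintegral_mono fun X => ?_
        by_cases hX : ∑ i ∈ S, X j i ^ 2 ≤ 2 * k
        · set x : Fin n → ℝ := fun i => √(SNR / k) * signal n S (X j) i with hx
          have hxs : 2 * ∑ i, x i ^ 2 + 1 ≤ 2 * b ^ 2 := by
            rw [hx, sum_signal_sq, Real.sq_sqrt (by positivity), hb2]
            have h1 : SNR / k * ∑ i ∈ S, X j i ^ 2 ≤ SNR / k * (2 * k) := by gcongr
            have h2 : SNR / k * (2 * k) = 2 * SNR := by field_simp
            linarith
          have htail := correlation_tail (m := m) x v hb hq ht hxs hv htq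
          have hpm : MeasurableSet {p : Fin m → (Fin n → ℝ) × ℝ | m * (t * q) ≤
              ∑ r, (∑ i, (p r).1 i * v i) * (∑ i, (p r).1 i * x i + (p r).2) -
                m * ∑ i, v i * x i} := measurableSet_le (by fun_prop) (by fun_prop)
          rw [← (measurePreserving_rows (n := n) (m := m) j).measure_preimage
            hpm.nullMeasurableSet] at htail
          refine le_trans (measure_mono fun p hp => ?_) htail
          have hp2 := hp.2
          rw [sum_mul_filterError] at hp2
          exact hp2
        · have : Prod.mk X ⁻¹' {ω : Omega n m J | ∑ i ∈ S, ω.1 j i ^ 2 ≤ 2 * k ∧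
              m * (t * q) ≤ ∑ i, v i * filterError n m J SNR k S ω j i} = ∅ := by
            ext p
            simp only [Set.mem_preimage, Set.mem_ofPred_eq, Set.mem_empty_iff_false, iff_false]
            exact fun h => hX h.1
          rw [this]; simp
    _ = _ := by simp

lemma measure_many_filterErrors_le {n m J k q : ℕ} {SNR t b : ℝ} (hSNR : 0 ≤ SNR) (hb : 0 < b)
    (hb2 : b ^ 2 = 1 + 2 * SNR) (hq : 0 < q) (ht : 0 ≤ t) (htq : t * √q ≤ 4 * b) (hk : 1 ≤ k)
    (S : Finset (Fin n)) (j : Fin J) :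
    omegaLaw n m J {ω | ∑ i ∈ S, ω.1 j i ^ 2 ≤ 2 * k ∧
      2 * q ≤ (Finset.univ.filter fun i => m * t ≤ |filterError n m J SNR k S ω j i|).card} ≤
      n.choose q * (4 * ENNReal.ofReal (exp (-(m * (t ^ 2 * q / (64 * b ^ 2)))))) := by
  classical
  set v : ℝ → Finset (Fin n) → Fin n → ℝ := fun s F i => if i ∈ F then s else 0 with hvdef
  set B : ℝ → Finset (Fin n) → Set (Omega n m J) := fun s F =>
    {ω | ∑ i ∈ S, ω.1 j i ^ 2 ≤ 2 * k ∧
      m * (t * q) ≤ ∑ i, v s F i * filterError n m J SNR k S ω j i} with hB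
  have hpick : ∀ (s : ℝ) (ω : Omega n m J) (G : Finset (Fin n)),
      ∑ i ∈ S, ω.1 j i ^ 2 ≤ 2 * k → q ≤ G.card →
      (∀ i ∈ G, m * t ≤ s * filterError n m J SNR k S ω j i) →
      ∃ F ∈ (Finset.univ : Finset (Fin n)).powersetCard q, ω ∈ B s F := by
    intro s ω G hS hG h
    obtain ⟨F, hFG, hFq⟩ := Finset.exists_subset_card_eq hG
    refine ⟨F, Finset.mem_powersetCard.2 ⟨Finset.subset_univ _, hFq⟩, hS, ?_⟩
    have h1 : ∑ i, v s F i * filterError n m J SNR k S ω j i =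
        ∑ i ∈ F, s * filterError n m J SNR k S ω j i := by
      simp only [hvdef, ite_mul, zero_mul]
      rw [Finset.sum_ite_mem, Finset.univ_inter]
    rw [h1]
    calc (m : ℝ) * (t * q) = ∑ i ∈ F, (m : ℝ) * t := by
          rw [Finset.sum_const, hFq, nsmul_eq_mul]; ring
      _ ≤ _ := Finset.sum_le_sum fun i hi => h i (hFG hi)
  have hsub : {ω : Omega n m J | ∑ i ∈ S, ω.1 j i ^ 2 ≤ 2 * k ∧
      2 * q ≤ (Finset.univ.filter fun i => m * t ≤ |filterError n m J SNR k S ω j i|).card} ⊆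
      ⋃ F ∈ (Finset.univ : Finset (Fin n)).powersetCard q, (B 1 F ∪ B (-1) F) := by
    rintro ω ⟨hS, hω⟩
    set P := Finset.univ.filter fun i => m * t ≤ 1 * filterError n m J SNR k S ω j i
    set N := Finset.univ.filter fun i => m * t ≤ -1 * filterError n m J SNR k S ω j i
    have hPN : (Finset.univ.filter fun i => m * t ≤ |filterError n m J SNR k S ω j i|) ⊆ P ∪ N := by
      intro i hi
      simp only [P, N, Finset.mem_union, Finset.mem_filter, Finset.mem_univ, true_and, one_mul,
        neg_one_mul] at hi ⊢
      exact le_abs.1 hi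
    have hcard := hω.trans ((Finset.card_le_card hPN).trans (Finset.card_union_le _ _))
    rcases (show q ≤ P.card ∨ q ≤ N.card by omega) with h | h
    · obtain ⟨F, hF, hFB⟩ := hpick 1 ω P hS h fun i hi => (Finset.mem_filter.1 hi).2
      exact Set.mem_biUnion hF (Or.inl hFB)
    · obtain ⟨F, hF, hFB⟩ := hpick (-1) ω N hS h fun i hi => (Finset.mem_filter.1 hi).2
      exact Set.mem_biUnion hF (Or.inr hFB)
  have hv : ∀ s : ℝ, s ^ 2 = 1 → ∀ F ∈ (Finset.univ : Finset (Fin n)).powersetCard q,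
      omegaLaw n m J (B s F) ≤ 2 * ENNReal.ofReal (exp (-(m * (t ^ 2 * q / (64 * b ^ 2))))) := by
    intro s hs F hF
    refine measure_filterError_sum_le hSNR hb hb2 (by exact_mod_cast hq) ht htq hk S j (v s F) ?_
    have h1 : ∀ i, v s F i ^ 2 = if i ∈ F then 1 else 0 := fun i => by
      simp only [hvdef]; split_ifs <;> simp [hs]
    simp_rw [h1]
    simp [(Finset.mem_powersetCard.1 hF).2]
  calc _ ≤ ∑ F ∈ (Finset.univ : Finset (Fin n)).powersetCard q,
          omegaLaw n m J (B 1 F ∪ B (-1) F) :=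
        (measure_mono hsub).trans (measure_biUnion_finset_le _ _)
    _ ≤ ∑ F ∈ (Finset.univ : Finset (Fin n)).powersetCard q,
          (4 * ENNReal.ofReal (exp (-(m * (t ^ 2 * q / (64 * b ^ 2)))))) := by
        refine Finset.sum_le_sum fun F hF => ?_
        refine (measure_union_le _ _).trans ((add_le_add (hv 1 (by norm_num) F hF)
          (hv (-1) (by norm_num) F hF)).trans_eq ?_)
        rw [← add_mul]; norm_num
    _ = _ := by simp

/-- Matched filter followed by thresholding. -/
def matchedFilter (n m J : ℕ) (t : ℝ) : Estimator n m J :=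
  fun y A => Finset.univ.filter fun i => ∃ j, 2 * (m * t) ≤ |∑ r, A j r i * y j r|

lemma distor_matchedFilter_le {n m J k q : ℕ} (hk : 1 ≤ k) {SNR t τ α : ℝ} (ht : 0 ≤ t)
    (hτ : √(SNR / k) * τ = 3 * t) {S : Finset (Fin n)} {ω : Omega n m J}
    (hsmall : (S.filter fun i => ∀ j, |ω.1 j i| < τ).card < q)
    (herr : ∀ j, (Finset.univ.filter fun i =>
      m * t ≤ |filterError n m J SNR k S ω j i|).card < 2 * q)
    (hq : (1 + 2 * J) * q ≤ α * k) :
    distor k S (matchedFilter n m J t (Yobs n m J SNR k S ω) ω.2.1) ≤ α := by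
  classical
  set T := matchedFilter n m J t (Yobs n m J SNR k S ω) ω.2.1 with hT
  set B : Fin J → Finset (Fin n) := fun j =>
    Finset.univ.filter fun i => m * t ≤ |filterError n m J SNR k S ω j i| with hB
  have hmem : ∀ i, i ∈ T ↔ ∃ j, 2 * (m * t) ≤ |filterError n m J SNR k S ω j i +
      m * (√(SNR / k) * signal n S (ω.1 j) i)| := by
    intro i
    simp [hT, matchedFilter, filterError]
  have hmt : 0 ≤ m * t := by positivity
  have hU : ((Finset.univ : Finset (Fin J)).biUnion B).card ≤ J * (2 * q) := by
    refine Finset.card_biUnion_le.trans ((Finset.sum_le_sum fun j _ => (herr j).le).trans_eq ?_)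
    simp
  have h1 : T \ S ⊆ (Finset.univ : Finset (Fin J)).biUnion B := by
    intro i hi
    rw [Finset.mem_sdiff, hmem] at hi
    obtain ⟨⟨j, hj⟩, hiS⟩ := hi
    refine Finset.mem_biUnion.2 ⟨j, Finset.mem_univ _, Finset.mem_filter.2 ⟨Finset.mem_univ _, ?_⟩⟩
    simp only [signal, hiS, if_false, mul_zero, add_zero] at hj
    linarith
  have h2 : S \ T ⊆ (S.filter fun i => ∀ j, |ω.1 j i| < τ) ∪
      (Finset.univ : Finset (Fin J)).biUnion B := by
    intro i hi
    rw [Finset.mem_sdiff, hmem] at hi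
    obtain ⟨hiS, hi⟩ := hi
    push Not at hi
    by_cases hs : ∀ j, |ω.1 j i| < τ
    · exact Finset.mem_union_left _ (Finset.mem_filter.2 ⟨hiS, hs⟩)
    · push Not at hs
      obtain ⟨j, hj⟩ := hs
      refine Finset.mem_union_right _ (Finset.mem_biUnion.2 ⟨j, Finset.mem_univ _,
        Finset.mem_filter.2 ⟨Finset.mem_univ _, ?_⟩⟩)
      have h3 := hi j
      simp only [signal, hiS, if_true] at h3
      have h4 : 3 * (m * t) ≤ |(m : ℝ) * (√(SNR / k) * ω.1 j i)| := by
        rw [abs_mul, abs_mul, abs_of_nonneg (Nat.cast_nonneg m), abs_of_nonneg (Real.sqrt_nonneg _)]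
        calc 3 * (m * t) = m * (√(SNR / k) * τ) := by rw [hτ]; ring
          _ ≤ _ := by gcongr
      have h5 := abs_sub_abs_le_abs_add ((m : ℝ) * (√(SNR / k) * ω.1 j i))
        (filterError n m J SNR k S ω j i)
      rw [add_comm] at h3
      linarith
  have hqr : ((J * (2 * q) : ℕ) : ℝ) ≤ α * k := by
    refine le_trans ?_ hq
    push_cast
    have : (0 : ℝ) ≤ q := Nat.cast_nonneg _
    linarith
  refine (distor_le_iff hk).2 ⟨?_, ?_⟩
  · have h3 : (S \ T).card ≤ q + J * (2 * q) :=
      (Finset.card_le_card h2).trans ((Finset.card_union_le _ _).trans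
        (Nat.add_le_add hsmall.le hU))
    refine le_trans (Nat.cast_le.2 h3) (le_trans (le_of_eq ?_) hq)
    push_cast; ring
  · exact le_trans (Nat.cast_le.2 ((Finset.card_le_card h1).trans hU)) hqr

lemma choose_le_exp_mul_div_pow (N : ℕ) {q : ℕ} (hq : 0 < q) :
    (N.choose q : ℝ) ≤ (exp 1 * N / q) ^ q := by
  have hq0 : (0 : ℝ) < q := by exact_mod_cast hq
  have h1 : (N.choose q : ℝ) ≤ (N : ℝ) ^ q / q.factorial := Nat.choose_le_pow_div q N
  have h2 : (q : ℝ) ^ q / q.factorial ≤ exp q := Real.pow_div_factorial_le_exp _ hq0.le q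
  have hf : (0 : ℝ) < q.factorial := by exact_mod_cast q.factorial_pos
  refine h1.trans ?_
  rw [div_pow, mul_pow, ← Real.exp_nat_mul, mul_one, div_le_div_iff₀ hf (by positivity)]
  rw [div_le_iff₀ hf] at h2
  calc (N : ℝ) ^ q * q ^ q ≤ (N : ℝ) ^ q * (exp q * q.factorial) := by gcongr
    _ = _ := by ring

lemma errProb_matchedFilter_le {n m J k q : ℕ} (hq : 0 < q) (hqk : q ≤ k) {SNR τ α : ℝ}
    (hSNR : 0 ≤ SNR) (hτ0 : 0 < τ) (hτ1 : τ ≤ 1) (hqα : (1 + 2 * J) * q ≤ α * k)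
    (hτq : exp 1 * k / q * τ ^ J ≤ exp (-1))
    (hmq : Real.log (exp 1 * n / q) + 1 ≤
      m * (SNR * τ ^ 2 / (576 * (1 + 2 * SNR) * k))) :
    errProb n m J k SNR α (matchedFilter n m J (√(SNR / k) * τ / 3)) ≤
      J * exp (-(k / 16)) + exp (-q) + J * (4 * exp (-q)) := by
  classical
  have hk : 1 ≤ k := hq.trans_le hqk
  have hk0 : (0 : ℝ) < k := by exact_mod_cast hk
  have hq0 : (0 : ℝ) < q := by exact_mod_cast hq
  set t := √(SNR / k) * τ / 3 with ht
  have ht0 : 0 ≤ t := by positivity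
  have ht2 : t ^ 2 = SNR * τ ^ 2 / (9 * k) := by
    rw [ht, div_pow, mul_pow, Real.sq_sqrt (by positivity)]; field_simp; norm_num
  set b := √(1 + 2 * SNR) with hb
  have hb0 : 0 < b := Real.sqrt_pos.2 (by linarith)
  have hb2 : b ^ 2 = 1 + 2 * SNR := Real.sq_sqrt (by linarith)
  have htq : t * √q ≤ 4 * b := by
    refine (sq_le_sq₀ (by positivity) (by positivity)).1 ?_
    rw [mul_pow, mul_pow, Real.sq_sqrt hq0.le, ht2, hb2]
    have h1 : SNR * τ ^ 2 / (9 * k) * q ≤ SNR := by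
      rw [div_mul_eq_mul_div, div_le_iff₀ (by positivity)]
      have h2 : τ ^ 2 * q ≤ 1 * k := by
        have : (q : ℝ) ≤ k := by exact_mod_cast hqk
        gcongr
        exact pow_le_one₀ hτ0.le hτ1
      nlinarith
    linarith
  set bound := J * exp (-(k / 16)) + exp (-q) + J * (4 * exp (-q)) with hbound
  have hbound0 : 0 ≤ bound := by positivity
  have hb_small : (k.choose q : ℝ) * τ ^ (q * J) ≤ exp (-q) := by
    calc (k.choose q : ℝ) * τ ^ (q * J) ≤ (exp 1 * k / q) ^ q * τ ^ (q * J) := by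
          gcongr; exact choose_le_exp_mul_div_pow k hq
      _ = (exp 1 * k / q * τ ^ J) ^ q := by rw [mul_pow, ← pow_mul, mul_comm J]
      _ ≤ exp (-1) ^ q := by gcongr
      _ = _ := by rw [← Real.exp_nat_mul]; congr 1; ring
  have hb_noise : (n.choose q : ℝ) * exp (-(m * (t ^ 2 * q / (64 * b ^ 2)))) ≤ exp (-q) := by
    have h1 : (n.choose q : ℝ) ≤ exp (q * Real.log (exp 1 * n / q)) := by
      rcases Nat.eq_zero_or_pos n with hn | hn
      · rw [hn, Nat.choose_eq_zero_of_lt hq]; simp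
      · have hn0 : (0 : ℝ) < n := by exact_mod_cast hn
        refine (choose_le_exp_mul_div_pow n hq).trans_eq ?_
        rw [Real.exp_nat_mul, Real.exp_log (by positivity)]
    calc _ ≤ exp (q * Real.log (exp 1 * n / q)) * exp (-(m * (t ^ 2 * q / (64 * b ^ 2)))) := by
          gcongr
      _ ≤ _ := by
          rw [← Real.exp_add, Real.exp_le_exp]
          have h2 : (m : ℝ) * (t ^ 2 * q / (64 * b ^ 2)) =
              q * (m * (SNR * τ ^ 2 / (576 * (1 + 2 * SNR) * k))) := by
            rw [ht2, hb2]; field_simp; ring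
          rw [h2]
          nlinarith
  have hS : ∀ S ∈ patterns n k, (omegaLaw n m J
      {ω | α < distor k S (matchedFilter n m J t (Yobs n m J SNR k S ω) ω.2.1)}).toReal ≤
      bound := by
    intro S hS
    have hSk : S.card = k := by simpa [patterns, Finset.mem_powersetCard_univ] using hS
    refine ENNReal.toReal_le_of_le_ofReal hbound0 ?_
    set E1 : Fin J → Set (Omega n m J) := fun j => {ω | 2 * (k : ℝ) < ∑ i ∈ S, ω.1 j i ^ 2}
    set E2 : Set (Omega n m J) := {ω | q ≤ (S.filter fun i => ∀ j, |ω.1 j i| < τ).card}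
    set E3 : Fin J → Set (Omega n m J) := fun j => {ω | ∑ i ∈ S, ω.1 j i ^ 2 ≤ 2 * k ∧
      2 * q ≤ (Finset.univ.filter fun i => m * t ≤ |filterError n m J SNR k S ω j i|).card}
    have hsub : {ω | α < distor k S (matchedFilter n m J t (Yobs n m J SNR k S ω) ω.2.1)} ⊆
        (⋃ j ∈ (Finset.univ : Finset (Fin J)), E1 j) ∪ E2 ∪
          ⋃ j ∈ (Finset.univ : Finset (Fin J)), E3 j := by
      intro ω hω
      by_contra hcon
      simp only [Set.mem_union, Set.mem_iUnion, Finset.mem_univ, exists_prop, true_and, not_or,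
        not_exists] at hcon
      obtain ⟨⟨h1, h2⟩, h3⟩ := hcon
      refine not_le.2 hω (distor_matchedFilter_le hk ht0 (by rw [ht]; ring) (not_le.1 h2)
        (fun j => not_le.1 fun h => h3 j ⟨not_lt.1 (h1 j), h⟩) hqα)
    have h1 : omegaLaw n m J (⋃ j ∈ (Finset.univ : Finset (Fin J)), E1 j) ≤
        ENNReal.ofReal (J * exp (-(k / 16))) := by
      refine (measure_biUnion_finset_le _ _).trans ((Finset.sum_le_sum fun j _ =>
        measure_large_energy_le hSk j).trans_eq ?_)
      rw [ENNReal.ofReal_mul (by positivity)]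
      simp
    have h2 : omegaLaw n m J E2 ≤ ENNReal.ofReal (exp (-q)) := by
      refine (measure_many_small_le hSk).trans ?_
      rw [← ENNReal.ofReal_pow hτ0.le, ← ENNReal.ofReal_natCast,
        ← ENNReal.ofReal_mul (by positivity)]
      exact ENNReal.ofReal_le_ofReal hb_small
    have h3 : omegaLaw n m J (⋃ j ∈ (Finset.univ : Finset (Fin J)), E3 j) ≤
        ENNReal.ofReal (J * (4 * exp (-q))) := by
      refine (measure_biUnion_finset_le _ _).trans ((Finset.sum_le_sum fun j _ =>
        measure_many_filterErrors_le hSNR hb0 hb2 hq ht0 htq hk S j).trans ?_)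
      rw [Finset.sum_const, Finset.card_univ, Fintype.card_fin, nsmul_eq_mul,
        ENNReal.ofReal_mul (by positivity), ENNReal.ofReal_natCast]
      gcongr
      rw [mul_left_comm, ENNReal.ofReal_mul (by norm_num), ENNReal.ofReal_ofNat]
      gcongr
      rw [← ENNReal.ofReal_natCast, ← ENNReal.ofReal_mul (by positivity)]
      exact ENNReal.ofReal_le_ofReal hb_noise
    refine (measure_mono hsub).trans ((measure_union_le _ _).trans ((add_le_add
      ((measure_union_le _ _).trans (add_le_add h1 h2)) h3).trans_eq ?_))
    rw [← ENNReal.ofReal_add (by positivity) (by positivity),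
      ← ENNReal.ofReal_add (by positivity) (by positivity)]
  unfold errProb
  calc _ ≤ (n.choose k : ℝ)⁻¹ * ∑ S ∈ patterns n k, bound := by
        gcongr with S hSm
        exact hS S hSm
    _ = (n.choose k : ℝ)⁻¹ * n.choose k * bound := by simp [patterns, mul_assoc]
    _ ≤ 1 * bound := by
        gcongr
        exact inv_mul_le_one
    _ = bound := one_mul _

lemma achievable_of_rate {J : ℕ} {κ SNR α β τ r : ℝ} (hκ : 0 < κ) (hSNR : 0 < SNR)
    (hβ : 0 < β) (hβ1 : β ≤ 1) (hβα : (1 + 2 * J) * β ≤ α) (hτ0 : 0 < τ) (hτ1 : τ ≤ 1)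
    (hτ : τ ^ J < β * exp (-2)) (hr0 : 0 ≤ r)
    (hr : 2 + Real.log (1 / (κ * β)) < r * (SNR * τ ^ 2 / (576 * (1 + 2 * SNR) * κ))) :
    achievable κ SNR (J * r) J α := by
  set k : ℕ → ℕ := fun n => ⌊κ * (n : ℝ)⌋₊ with hkdef
  set q : ℕ → ℕ := fun n => ⌊β * (k n : ℝ)⌋₊ with hqdef
  set m : ℕ → ℕ := fun n => ⌈r * (n : ℝ)⌉₊ with hmdef
  have hn : Tendsto (fun n : ℕ => (n : ℝ)) atTop atTop := tendsto_natCast_atTop_atTop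
  have hk : Tendsto (fun n => (k n : ℝ) / n) atTop (𝓝 κ) :=
    (tendsto_nat_floor_mul_div_atTop hκ.le).comp hn
  have hm : Tendsto (fun n => (m n : ℝ) / n) atTop (𝓝 r) :=
    (tendsto_nat_ceil_mul_div_atTop hr0).comp hn
  have hkinf : Tendsto (fun n => (k n : ℝ)) atTop atTop :=
    hn.comp (tendsto_nat_floor_atTop.comp (hn.const_mul_atTop hκ))
  have hqinf : Tendsto (fun n => (q n : ℝ)) atTop atTop :=
    hn.comp (tendsto_nat_floor_atTop.comp (hkinf.const_mul_atTop hβ))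
  have hq : Tendsto (fun n => (q n : ℝ) / k n) atTop (𝓝 β) :=
    (tendsto_nat_floor_mul_div_atTop hβ.le).comp hkinf
  refine ⟨k, m, fun n => matchedFilter n (m n) J (√(SNR / k n) * τ / 3), hk, ?_, ?_⟩
  · refine (hm.const_mul (J : ℝ)).congr fun n => by rw [mul_div_assoc]
  · have hexpk : Tendsto (fun n => exp (-((k n : ℝ) / 16))) atTop (𝓝 0) :=
      Real.tendsto_exp_neg_atTop_nhds_zero.comp (hkinf.atTop_div_const (by norm_num))
    have hexpq : Tendsto (fun n => exp (-(q n : ℝ))) atTop (𝓝 0) :=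
      Real.tendsto_exp_neg_atTop_nhds_zero.comp hqinf
    have hbound : Tendsto (fun n => J * exp (-((k n : ℝ) / 16)) + exp (-(q n : ℝ)) +
        J * (4 * exp (-(q n : ℝ)))) atTop (𝓝 (J * 0 + 0 + J * (4 * 0))) :=
      ((hexpk.const_mul _).add hexpq).add ((hexpq.const_mul _).const_mul _)
    simp only [mul_zero, add_zero] at hbound
    have hτlim : Tendsto (fun n => exp 1 * ((q n : ℝ) / k n)⁻¹ * τ ^ J) atTop
        (𝓝 (exp 1 * β⁻¹ * τ ^ J)) := ((hq.inv₀ hβ.ne').const_mul _).mul_const _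
    have hτlt : exp 1 * β⁻¹ * τ ^ J < exp (-1) := by
      calc exp 1 * β⁻¹ * τ ^ J < exp 1 * β⁻¹ * (β * exp (-2)) := by gcongr
        _ = exp 1 * exp (-2) := by field_simp
        _ = exp (-1) := by rw [← Real.exp_add]; norm_num
    have hloglim : Tendsto (fun n => Real.log (exp 1 * ((q n : ℝ) / k n * (k n / n))⁻¹) + 1) atTop
        (𝓝 (Real.log (exp 1 * (β * κ)⁻¹) + 1)) :=
      ((((hq.mul hk).inv₀ (by positivity)).const_mul _).log (by positivity)).add_const _
    have hmlim : Tendsto (fun n => (m n : ℝ) / n * (SNR * τ ^ 2 / (576 * (1 + 2 * SNR) *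
        (k n / n)))) atTop (𝓝 (r * (SNR * τ ^ 2 / (576 * (1 + 2 * SNR) * κ)))) :=
      hm.mul (tendsto_const_nhds.div (hk.const_mul _) (by positivity))
    have hloglt : Real.log (exp 1 * (β * κ)⁻¹) + 1 <
        r * (SNR * τ ^ 2 / (576 * (1 + 2 * SNR) * κ)) := by
      refine lt_of_eq_of_lt ?_ hr
      rw [Real.log_mul (by positivity) (by positivity), Real.log_exp, one_div, mul_comm κ]
      ring
    refine squeeze_zero' (Eventually.of_forall fun n => ?_) ?_ hbound
    · exact mul_nonneg (by positivity) (Finset.sum_nonneg fun _ _ => ENNReal.toReal_nonneg)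
    · filter_upwards [eventually_gt_atTop 0, hkinf.eventually_gt_atTop 0,
        hqinf.eventually_gt_atTop 0, hτlim.eventually_lt_const hτlt,
        hloglim.eventually_lt hmlim hloglt] with n hn0 hk0 hq0 h1 h2
      have hn0' : (0 : ℝ) < n := by exact_mod_cast hn0
      have hqβ : (q n : ℝ) ≤ β * k n := Nat.floor_le (by positivity)
      have hqk : (q n : ℝ) ≤ k n := by nlinarith
      refine errProb_matchedFilter_le (by exact_mod_cast hq0) (by exact_mod_cast hqk) hSNR.le
        hτ0 hτ1 ?_ ?_ ?_
      · calc (1 + 2 * (J : ℝ)) * q n ≤ (1 + 2 * J) * (β * k n) := by gcongr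
          _ = (1 + 2 * J) * β * k n := by ring
          _ ≤ _ := by gcongr
      · refine le_of_eq_of_le ?_ h1.le
        rw [inv_div]; ring
      · refine le_of_eq_of_le ?_ (h2.le.trans_eq ?_)
        · congr 2
          field_simp
        · field_simp

lemma achievable_low_distortion {J : ℕ} (hJ : 1 ≤ J) {κ SNR α : ℝ} (hκ : κ ∈ Set.Ioo (0 : ℝ) (1 / 2))
    (hSNR : 0 < SNR) (hα : 0 < α) (hα1 : α ≤ exp (-1)) :
    achievable κ SNR (J * (576 * (1 + 2 * SNR) * κ * (4 + Real.log ((1 + 2 * J) / κ)) *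
      ((1 + 2 * J) * exp 3) ^ ((2 : ℝ) / J) / SNR) * (1 / α) ^ ((2 : ℝ) / J) *
        Real.log (1 / α)) J α := by
  obtain ⟨hκ0, hκ1⟩ := hκ
  have hJ0 : J ≠ 0 := by omega
  have hJr : (1 : ℝ) ≤ J := by exact_mod_cast hJ
  have hlogα : 1 ≤ Real.log (1 / α) := by
    rw [one_div, Real.log_inv, le_neg]
    exact (Real.log_le_iff_le_exp hα).2 hα1
  have hα1' : α ≤ 1 := hα1.trans (Real.exp_le_one_iff.2 (by norm_num))
  set C := (1 + 2 * (J : ℝ)) * exp 3 with hC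
  have hC0 : 0 < C := by positivity
  set τ := (α / C) ^ ((J : ℝ)⁻¹) with hτ
  have hτ0 : 0 < τ := by positivity
  have hτJ : τ ^ J = α / C := Real.rpow_inv_natCast_pow (by positivity) hJ0
  have hC1 : 1 ≤ C := by
    have : 1 ≤ exp 3 := Real.one_le_exp (by norm_num)
    nlinarith
  have hτ1 : τ ≤ 1 := Real.rpow_le_one (by positivity)
    (by rw [div_le_one hC0]; linarith) (by positivity)
  have hτ2 : τ ^ 2 = 1 / (C ^ ((2 : ℝ) / J) * (1 / α) ^ ((2 : ℝ) / J)) := by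
    rw [← Real.mul_rpow (by positivity) (by positivity), ← Real.rpow_natCast τ 2, hτ,
      ← Real.rpow_mul (by positivity), one_div (_ ^ _), ← Real.inv_rpow (by positivity)]
    congr 1
    · field_simp
    · push_cast; field_simp
  set D := Real.log ((1 + 2 * J) / κ) with hD
  have hD0 : 0 ≤ D := Real.log_nonneg (by rw [le_div_iff₀ hκ0]; linarith)
  have hA : 0 < (1 / α) ^ ((2 : ℝ) / J) := by positivity
  have hB : 0 < C ^ ((2 : ℝ) / J) := by positivity
  have h := achievable_of_rate (J := J) (κ := κ) (SNR := SNR) (α := α) (β := α / (1 + 2 * J))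
    (τ := τ) (r := 576 * (1 + 2 * SNR) * κ * (4 + D) * C ^ ((2 : ℝ) / J) / SNR *
      (1 / α) ^ ((2 : ℝ) / J) * Real.log (1 / α)) hκ0 hSNR (by positivity)
    (by rw [div_le_one (by positivity)]; linarith) (le_of_eq (by field_simp)) hτ0 hτ1
    (by
      rw [hτJ, hC, ← div_div, div_eq_mul_inv _ (exp 3), ← Real.exp_neg]
      gcongr
      norm_num) (by positivity) (by
      rw [hτ2]
      generalize (1 / α) ^ ((2 : ℝ) / J) = A at *
      generalize C ^ ((2 : ℝ) / J) = B at *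
      have h1 : Real.log (1 / (κ * (α / (1 + 2 * J)))) = D + Real.log (1 / α) := by
        rw [hD, ← Real.log_mul (by positivity) (by positivity)]
        congr 1; field_simp
      rw [h1]
      have h2 : 576 * (1 + 2 * SNR) * κ * (4 + D) * B / SNR * A * Real.log (1 / α) *
          (SNR * (1 / (B * A)) / (576 * (1 + 2 * SNR) * κ)) = (4 + D) * Real.log (1 / α) := by
        field_simp
      rw [h2]
      nlinarith)
  convert h using 1
  ring

lemma nonneg_of_achievable {κ SNR ρ α : ℝ} {J : ℕ} (h : achievable κ SNR ρ J α) : 0 ≤ ρ := by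
  obtain ⟨k, m, est, -, hm, -⟩ := h
  exact ge_of_tendsto' hm fun n => by positivity

/-- **Theorem 5** (Low-distortion scaling). For fixed `κ`, `J` and `SNR`, there are
constants `0 < C⁻ ≤ C⁺ < ∞` with
`C⁻·(1/α)^{2/J}·log(1/α) ≤ ρ(α) ≤ C⁺·(1/α)^{2/J}·log(1/α)` for all small enough `α`. -/
theorem low_distortion_scaling
    (κ SNR : ℝ) (J : ℕ) (hJ : 1 ≤ J)
    (hκ : κ ∈ Set.Ioo 0 (1/2)) (hSNR : 0 < SNR) :
    ∃ Cm Cp : ℝ, 0 < Cm ∧ Cm ≤ Cp ∧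
      ∃ α₀ > (0:ℝ), ∀ α : ℝ, 0 < α → α < α₀ →
        Cm * (1 / α) ^ ((2:ℝ) / J) * Real.log (1 / α) ≤ rhoStar κ SNR J α ∧
        rhoStar κ SNR J α ≤ Cp * (1 / α) ^ ((2:ℝ) / J) * Real.log (1 / α) := by
  set Cm := κ / (64 * SNR * 2 ^ ((2 : ℝ) / J)) with hCm
  set C' := J * (576 * (1 + 2 * SNR) * κ * (4 + Real.log ((1 + 2 * J) / κ)) *
      ((1 + 2 * J) * exp 3) ^ ((2 : ℝ) / J) / SNR) with hC'
  have hκ0 : 0 < κ := hκ.1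
  refine ⟨Cm, max Cm C', by positivity, le_max_left _ _,
    min (1 / 256) (min ((1 / 4) ^ J / 2) (exp (-1))), by positivity, fun α hα hα0 => ?_⟩
  obtain ⟨h1, h2⟩ := lt_min_iff.1 hα0
  obtain ⟨h2, h3⟩ := lt_min_iff.1 h2
  have hach := achievable_low_distortion hJ hκ hSNR hα h3.le
  have hlog : 0 ≤ Real.log (1 / α) := Real.log_nonneg (by
    rw [le_div_iff₀ hα]; linarith)
  unfold rhoStar
  constructor
  · exact le_csInf ⟨_, hach⟩ fun ρ hρ => converse_rate hJ hκ hSNR hα h1.le (by linarith) hρ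
  · refine (csInf_le ⟨0, fun ρ hρ => nonneg_of_achievable hρ⟩ hach).trans ?_
    gcongr
    exact le_max_right _ _

end Sparsity
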